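/- arXiv:2503.03159 — 7 statements merged into one kernel-verified Lean document; each statement's English description precedes it below -/
import Mathlib

section
/- For every natural number n > 5040 that is not divisible by at least one of the primes 2, 3, 5 (i.e., 2 ∤ n or 3 ∤ n or 5 ∤ n), Robin's inequality holds: σ(n) < e^γ · n · log(log n). -/
open Real

/-- Robin's inequality for `n`: `σ(n) < e^γ · n · log(log n)`. -/
def RobinInequality (n : ℕ) : Prop :=
  (ArithmeticFunction.sigma 1 n : ℝ) <
    Real.exp Real.eulerMascheroniConstant * n * Real.log (Real.log n)

lemma log_eq_sum_factorization {n : ℕ} (hn : n ≠ 0) :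
    log n = ∑ p ∈ n.primeFactors, n.factorization p * log p := by
  conv_lhs => rw [← Nat.prod_factorization_pow_eq_self hn]
  rw [Finsupp.prod, Nat.cast_prod, log_prod]
  · simp
  · intro p hp
    have := (Nat.prime_of_mem_primeFactors hp).pos
    positivity

lemma sigma_one_prime_pow_mul_le {p : ℕ} (hp : p.Prime) (a : ℕ) :
    (ArithmeticFunction.sigma 1 (p ^ a) : ℝ) * (p - 1) = p ^ (a + 1) - 1 := by
  rw [ArithmeticFunction.sigma_one_apply_prime_pow hp]
  push_cast
  exact geom_sum_mul (p : ℝ) (a + 1)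

/-- The logarithm of `σ(p ^ a) / p ^ a`. -/
noncomputable def logAbundancy (p a : ℕ) : ℝ :=
  log (ArithmeticFunction.sigma 1 (p ^ a)) - a * log p

lemma logAbundancy_le {p : ℕ} (hp : p.Prime) (a : ℕ) :
    logAbundancy p a ≤ log (p / (p - 1)) := by
  have hp1 : (1 : ℝ) < p := by exact_mod_cast hp.one_lt
  have hpos : 0 < ArithmeticFunction.sigma 1 (p ^ a) :=
    ArithmeticFunction.sigma_pos 1 _ (pow_pos hp.pos a).ne'
  have hs : (0 : ℝ) < ArithmeticFunction.sigma 1 (p ^ a) := by exact_mod_cast hpos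
  rw [logAbundancy, ← log_pow, ← log_div hs.ne' (by positivity)]
  apply log_le_log (by positivity)
  rw [div_le_div_iff₀ (by positivity) (by linarith), sigma_one_prime_pow_mul_le hp]
  rw [pow_succ]; linarith

lemma log_sigma_one_eq_sum {n : ℕ} (hn : n ≠ 0) :
    log (ArithmeticFunction.sigma 1 n) =
      log n + ∑ p ∈ n.primeFactors, logAbundancy p (n.factorization p) := by
  have h1 : (ArithmeticFunction.sigma 1 n) =
      ∏ p ∈ n.primeFactors, ArithmeticFunction.sigma 1 (p ^ n.factorization p) := by
    rw [ArithmeticFunction.isMultiplicative_sigma.multiplicative_factorization _ hn]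
    rfl
  have h2 := log_eq_sum_factorization hn
  rw [h1, Nat.cast_prod, log_prod, h2, ← Finset.sum_add_distrib]
  · exact Finset.sum_congr rfl fun p _ => by rw [logAbundancy]; ring
  · intro p hp
    have := ArithmeticFunction.sigma_pos 1 _
      (pow_pos (Nat.prime_of_mem_primeFactors hp).pos (n.factorization p)).ne'
    positivity

/-- Lagrangian bound for `log σ(n)`: the constraint `∑ v_p(n) log p = log n` is relaxed with
multiplier `c`, and the primes outside `T` do not contribute. -/
lemma log_sigma_one_le {n q : ℕ} (hn : n ≠ 0) (hq : ¬ q ∣ n) {c : ℝ} (g : ℕ → ℝ) (T : Finset ℕ)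
    (hT : ∀ p, p.Prime → p ∉ T → log (p / (p - 1)) ≤ c * log p) (hg0 : ∀ p ∈ T, 0 ≤ g p)
    (hg : ∀ p ∈ T, p.Prime → ∀ a, logAbundancy p a ≤ c * (a * log p) + g p) :
    log (ArithmeticFunction.sigma 1 n) ≤ log n + c * log n + ∑ p ∈ T.erase q, g p := by
  classical
  have h2 := log_eq_sum_factorization hn
  rw [log_sigma_one_eq_sum hn, add_assoc]
  gcongr
  rw [h2, Finset.mul_sum]
  have h3 : ∑ p ∈ n.primeFactors, (if p ∈ T then g p else 0) ≤ ∑ p ∈ T.erase q, g p := by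
    rw [← Finset.sum_filter]
    apply Finset.sum_le_sum_of_subset_of_nonneg
    · intro p hp
      simp only [Finset.mem_filter, Nat.mem_primeFactors] at hp
      simp only [Finset.mem_erase]
      refine ⟨?_, hp.2⟩
      rintro rfl
      exact hq hp.1.2.1
    · intro p hp _
      exact hg0 p (Finset.mem_of_mem_erase hp)
  refine le_trans ?_ (add_le_add_right h3 _)
  rw [← Finset.sum_add_distrib]
  apply Finset.sum_le_sum
  intro p hp
  have hpp := Nat.prime_of_mem_primeFactors hp
  split_ifs with h
  · exact hg p h hpp _
  · have hv : (1 : ℝ) ≤ n.factorization p := by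
      exact_mod_cast (hpp.dvd_iff_one_le_factorization hn).1 (Nat.dvd_of_mem_primeFactors hp)
    have h4 := hT p hpp h
    have hp1 : (1 : ℝ) < p := by exact_mod_cast hpp.one_lt
    have h5 : 0 ≤ log (p / (p - 1)) :=
      log_nonneg (by rw [le_div_iff₀ (by linarith)]; linarith)
    have h6 := logAbundancy_le hpp (n.factorization p)
    nlinarith [mul_le_mul_of_nonneg_right hv (h5.trans h4)]

lemma log_factorial_eq_sum (N : ℕ) :
    log N.factorial = ∑ p ∈ N.primesLE, N.factorial.factorization p * log p := by
  rw [log_eq_sum_factorization N.factorial_ne_zero]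
  congr 1
  ext p
  simp only [Nat.mem_primeFactors, Nat.mem_primesLE]
  constructor
  · rintro ⟨hp, h, -⟩
    exact ⟨hp.dvd_factorial.1 h, hp⟩
  · rintro ⟨h, hp⟩
    exact ⟨hp, hp.dvd_factorial.2 h, N.factorial_ne_zero⟩

lemma log_factorial_le_mul_sum (N : ℕ) :
    log N.factorial ≤ N * ∑ p ∈ N.primesLE, log p / (p - 1) := by
  rw [log_factorial_eq_sum, Finset.mul_sum]
  apply Finset.sum_le_sum
  intro p hp
  have hpp := Nat.prime_of_mem_primesLE hp
  have hp1 : (1 : ℝ) < p := by exact_mod_cast hpp.one_lt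
  have h := Nat.sub_one_mul_factorization_factorial (n := N) hpp
  have h2 : ((p - 1 : ℕ) : ℝ) * N.factorial.factorization p ≤ N := by
    exact_mod_cast h.trans_le (Nat.sub_le _ _)
  rw [Nat.cast_pred hpp.pos] at h2
  rw [mul_div_assoc', le_div_iff₀ (by linarith)]
  have := log_nonneg hp1.le
  nlinarith

lemma mul_sum_log_div_le (N : ℕ) :
    N * ∑ p ∈ N.primesLE, log p / p ≤ log N.factorial + ∑ p ∈ N.primesLE, log p := by
  rw [log_factorial_eq_sum, Finset.mul_sum, ← Finset.sum_add_distrib]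
  apply Finset.sum_le_sum
  intro p hp
  have hpp := Nat.prime_of_mem_primesLE hp
  have hp1 : (1 : ℝ) < p := by exact_mod_cast hpp.one_lt
  have h1 : N / p ≤ N.factorial.factorization p := by
    rw [← hpp.pow_dvd_iff_le_factorization N.factorial_ne_zero]
    have h3 : (p ^ (N / p)) ∣ (p * (N / p)).factorial := by
      have := Nat.factorization_factorial_mul (n := N / p) hpp
      rw [hpp.pow_dvd_iff_le_factorization (Nat.factorial_ne_zero _), this]
      exact Nat.le_add_left _ _
    exact h3.trans (Nat.factorial_dvd_factorial (Nat.mul_div_le N p))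
  have h2 : (N : ℝ) / p ≤ N.factorial.factorization p + 1 := by
    have h4 : (N : ℝ) / p < (N / p : ℕ) + 1 := by
      rw [← Nat.floor_div_eq_div (K := ℝ)]
      exact Nat.lt_floor_add_one _
    have h5 : ((N / p : ℕ) : ℝ) ≤ N.factorial.factorization p := by exact_mod_cast h1
    linarith
  have := mul_le_mul_of_nonneg_right h2 (log_nonneg hp1.le)
  calc (N : ℝ) * (log p / p) = N / p * log p := by ring
    _ ≤ _ := by linarith

lemma log_factorial_le {N : ℕ} (hN : 1 ≤ N) : log N.factorial ≤ N * log N - N + log N + 1 := by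
  induction N, hN using Nat.le_induction with
  | base => simp
  | succ n hn ih =>
    have hn0 : (0 : ℝ) < n := by exact_mod_cast hn
    rw [Nat.factorial_succ]
    push_cast
    rw [log_mul (by positivity) (by positivity)]
    have h := one_sub_inv_le_log_of_pos (x := ((n : ℝ) + 1) / n) (by positivity)
    rw [log_div (by positivity) (by positivity), inv_div] at h
    have h2 : (1 : ℝ) ≤ (n + 1) * (log (n + 1) - log n) := by
      calc (1 : ℝ) = (n + 1) * (1 - n / (n + 1)) := by field_simp; ring
        _ ≤ _ := by gcongr
    linarith

lemma le_log_factorial {N : ℕ} (hN : 1 ≤ N) : N * log N - N ≤ log N.factorial := by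
  have h := Stirling.le_log_factorial_stirling (n := N) (by omega)
  have h1 : 0 ≤ log N := log_natCast_nonneg N
  have h2 : 0 ≤ log (2 * π) := log_nonneg (by nlinarith [pi_gt_three])
  linarith

/-- Telescoping bound for the tail of `∑ log m / (m (m - 1))`. -/
lemma sum_log_div_mul_sub_one_le (M : ℕ) (hM : 1 ≤ M) (N : ℕ) (hN : M ≤ N) :
    ∑ m ∈ Finset.Ioc M N, log m / (m * (m - 1)) ≤
      (log (M + 1) + 1) / M - (log (N + 1) + 1) / N := by
  induction N, hN using Nat.le_induction with
  | base => simp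
  | succ n hn ih =>
    rw [← Finset.insert_Ioc_right_eq_Ioc_add_one (by omega), Finset.sum_insert (by simp)]
    have hn0 : (0 : ℝ) < n := by exact_mod_cast (by omega : 0 < n)
    push_cast
    have h := log_le_sub_one_of_pos (x := ((n : ℝ) + 1 + 1) / (n + 1)) (by positivity)
    rw [log_div (by positivity) (by positivity)] at h
    have h1 : log ((n : ℝ) + 1 + 1) ≤ log (n + 1) + 1 / (n + 1) := by
      have : ((n : ℝ) + 1 + 1) / (n + 1) - 1 = 1 / (n + 1) := by field_simp; ring
      linarith
    have h2 : (log ((n : ℝ) + 1 + 1) + 1) / (n + 1) ≤ (log (n + 1) + 1 / (n + 1) + 1) / (n + 1) := by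
      gcongr
    have h3 : log ((n : ℝ) + 1) / ((n + 1) * (n + 1 - 1)) + (log (n + 1) + 1 / (n + 1) + 1) / (n + 1)
        ≤ (log (n + 1) + 1) / n := by
      rw [← sub_nonneg]
      generalize log ((n : ℝ) + 1) = L
      have : (L + 1) / n - (L / ((n + 1) * (n + 1 - 1)) + (L + 1 / (n + 1) + 1) / (n + 1)) = 1 / (n * (n + 1) ^ 2) := by
        rw [add_sub_cancel_right]
        field_simp
        ring
      rw [this]
      positivity
    linarith

/-- `log m ≤ k / j`, certified by an integer power of the bound `e > 2.7182818283`. -/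
lemma log_le_of_pow_le {m k j : ℕ} (hm : 0 < m) (hj : 0 < j)
    (h : m ^ j * 10000000000 ^ k ≤ 27182818283 ^ k) : log m ≤ k / j := by
  have he : (2.7182818283 : ℝ) < exp 1 := exp_one_gt_d9
  rw [le_div_iff₀ (by positivity), mul_comm, ← log_pow, log_le_iff_le_exp (by positivity)]
  have h2 : (m : ℝ) ^ j * 10000000000 ^ k ≤ 27182818283 ^ k := by exact_mod_cast h
  calc (m : ℝ) ^ j ≤ 27182818283 ^ k / 10000000000 ^ k := by rwa [le_div_iff₀ (by positivity)]
    _ = 2.7182818283 ^ k := by rw [← div_pow]; norm_num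
    _ ≤ exp 1 ^ k := by gcongr
    _ = exp k := by rw [← exp_nat_mul, mul_one]

/-- A comparison of logarithms, certified by powers of the bound `e < 2.7182818286`. -/
lemma add_mul_log_le_log {i j u v : ℕ} (hu : 0 < u) (hv : 0 < v)
    (h : 27182818286 ^ j * u ^ i ≤ v * 10000000000 ^ j) : j + i * log u ≤ log v := by
  have he : exp 1 < (2.7182818286 : ℝ) := exp_one_lt_d9
  rw [← log_pow, le_log_iff_exp_le (by positivity), exp_add, exp_log (by positivity)]
  have h2 : (27182818286 : ℝ) ^ j * u ^ i ≤ v * 10000000000 ^ j := by exact_mod_cast h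
  calc exp j * (u : ℝ) ^ i = exp 1 ^ j * u ^ i := by rw [← exp_nat_mul, mul_one]
    _ ≤ 2.7182818286 ^ j * u ^ i := by gcongr
    _ = 27182818286 ^ j * u ^ i / 10000000000 ^ j := by
      rw [mul_div_right_comm, ← div_pow]
      norm_num
    _ ≤ _ := by rwa [div_le_iff₀ (by positivity)]

/-- `k / j ≤ log m`, certified by an integer power of the bound `e < 2.7182818286`. -/
lemma le_log_of_pow_le {m k j : ℕ} (hm : 0 < m) (hj : 0 < j)
    (h : 27182818286 ^ k ≤ m ^ j * 10000000000 ^ k) : (k / j : ℝ) ≤ log m := by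
  have h1 := add_mul_log_le_log (u := 1) (i := 0) (v := m ^ j) one_pos (by positivity)
    (by simpa using h)
  rw [Nat.cast_pow, log_pow] at h1
  rw [div_le_iff₀ (by positivity), mul_comm]
  simpa using h1

lemma sum_primesLE_log_div_le_one (N : ℕ) :
    ∑ p ∈ N.primesLE, log p / (p * (p - 1)) ≤ 1 := by
  have hnn : ∀ m : ℕ, 0 ≤ log m / ((m : ℝ) * (m - 1)) := by
    intro m
    rcases Nat.eq_zero_or_pos m with rfl | hm
    · simp
    · have : (1 : ℝ) ≤ m := by exact_mod_cast hm
      exact div_nonneg (log_natCast_nonneg m) (mul_nonneg (by linarith) (by linarith))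
  have hsub : N.primesLE ⊆ ({2, 3, 5, 7} : Finset ℕ) ∪ Finset.Ioc 10 (N + 10) := by
    intro p hp
    rw [Nat.mem_primesLE] at hp
    obtain ⟨h1, h2⟩ := hp
    simp only [Finset.mem_union, Finset.mem_Ioc]
    rcases le_or_gt p 10 with h | h
    · left
      interval_cases p <;> first | decide | (revert h2; decide)
    · right; omega
  have h1 := Finset.sum_le_sum_of_subset_of_nonneg hsub
    (f := fun m : ℕ => log m / ((m : ℝ) * (m - 1))) (fun m _ _ => hnn m)
  rw [Finset.sum_union (by
    rw [Finset.disjoint_left]; intro m; simp only [Finset.mem_insert, Finset.mem_singleton,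
      Finset.mem_Ioc]; omega)] at h1
  have h2 := sum_log_div_mul_sub_one_le 10 (by norm_num) (N + 10) (by omega)
  have h3 : 0 ≤ (log ((N + 10 : ℕ) + 1) + 1) / ((N + 10 : ℕ) : ℝ) := by
    have : 0 ≤ log (((N + 10 : ℕ) : ℝ) + 1) := by exact_mod_cast log_natCast_nonneg (N + 10 + 1)
    positivity
  have e2 : log (2 : ℕ) ≤ (694 : ℕ) / (1000 : ℕ) :=
    log_le_of_pow_le (by norm_num) (by norm_num) (by decide +kernel)
  have e3 : log (3 : ℕ) ≤ (1100 : ℕ) / (1000 : ℕ) :=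
    log_le_of_pow_le (by norm_num) (by norm_num) (by decide +kernel)
  have e5 : log (5 : ℕ) ≤ (1610 : ℕ) / (1000 : ℕ) :=
    log_le_of_pow_le (by norm_num) (by norm_num) (by decide +kernel)
  have e7 : log (7 : ℕ) ≤ (1946 : ℕ) / (1000 : ℕ) :=
    log_le_of_pow_le (by norm_num) (by norm_num) (by decide +kernel)
  have e11 : log (11 : ℕ) ≤ (2398 : ℕ) / (1000 : ℕ) :=
    log_le_of_pow_le (by norm_num) (by norm_num) (by decide +kernel)
  rw [Finset.sum_insert (by decide), Finset.sum_insert (by decide), Finset.sum_insert (by decide),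
    Finset.sum_singleton] at h1
  push_cast at *
  norm_num at *
  linarith

lemma log_log_le_of_weighted_sum {P A : ℕ → ℝ} {K : ℝ} {N : ℕ} (hN : 2 ≤ N)
    (hPA : ∀ n, A (n + 1) - A n = log (n + 1) * (P (n + 1) - P n))
    (hA : ∀ n, N ≤ n → log n - K ≤ A n - A N) {t : ℕ} (ht : N ≤ t) :
    log (log t) + (P N - log (log N) + 1 - (K + 1 / N) / log N) ≤ P t := by
  have hN1 : (1 : ℝ) < N := by exact_mod_cast hN
  have key : P N + log (log t) - log (log N) - (K + 1 / N) * (1 / log N - 1 / log t) ≤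
      P t - (A t - A N) / log t := by
    induction t, ht using Nat.le_induction with
    | base => simp
    | succ n hn ih =>
      have hNn : (N : ℝ) ≤ n := by exact_mod_cast hn
      have hn0 : (0 : ℝ) < n := by linarith
      have hS := hA n hn
      have hstep := hPA n
      have hu : 0 < log n := log_pos (by linarith)
      have hv : 0 < log ((n : ℝ) + 1) := log_pos (by linarith)
      have huv : log ((n : ℝ) + 1) ≤ log n + 1 / N := by
        have h := log_le_sub_one_of_pos (x := ((n : ℝ) + 1) / n) (by positivity)
        rw [log_div (by positivity) (by positivity), add_div, div_self hn0.ne'] at h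
        have : 1 / (n : ℝ) ≤ 1 / N := by gcongr
        linarith
      have hle : log (n : ℝ) ≤ log ((n : ℝ) + 1) := log_le_log hn0 (by linarith)
      have hlog : log (log ((n : ℝ) + 1)) - log (log n) ≤
          (log ((n : ℝ) + 1) - log n) / log n := by
        have h := log_le_sub_one_of_pos (x := log ((n : ℝ) + 1) / log n) (by positivity)
        rw [log_div hv.ne' hu.ne'] at h
        rwa [sub_div, div_self hu.ne']
      push_cast at *
      generalize log ((n : ℝ) + 1) = v at *
      generalize log (n : ℝ) = u at *
      have hd : 0 ≤ 1 / u - 1 / v := by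
        rw [sub_nonneg]; gcongr
      have h1 : (v - u) / u ≤ (u + 1 / N) * (1 / u - 1 / v) := by
        have : (u + 1 / N) * (1 / u - 1 / v) - (v - u) / u =
            (u + 1 / N - v) * (v - u) / (u * v) := by
          field_simp
        have h2 : 0 ≤ (u + 1 / N - v) * (v - u) / (u * v) :=
          div_nonneg (mul_nonneg (by linarith) (by linarith)) (by positivity)
        linarith
      have h2 : (u - K) * (1 / u - 1 / v) ≤ (A n - A N) * (1 / u - 1 / v) := by gcongr
      have h3 : P (n + 1) - (A (n + 1) - A N) / v =
          P n - (A n - A N) / u + (A n - A N) * (1 / u - 1 / v) := by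
        have : A (n + 1) = A n + v * (P (n + 1) - P n) := by linarith
        rw [this]
        field_simp
        ring
      rw [h3]
      nlinarith
  have ht1 : (1 : ℝ) < t := by exact_mod_cast (by omega : 1 < t)
  have hlt : 0 < log t := log_pos ht1
  have h1 : 1 - K / log t ≤ (A t - A N) / log t := by
    rw [le_div_iff₀ hlt, sub_mul, div_mul_cancel₀ _ hlt.ne', one_mul]
    exact hA t ht
  have h2 : (K + 1 / N) * (1 / log N - 1 / log t) =
    (K + 1 / N) / log N - K / log t - 1 / N / log t := by ring
  have h3 : 0 ≤ 1 / (N : ℝ) / log t := by positivity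
  linarith

lemma sum_primesLE_succ (f : ℕ → ℝ) (n : ℕ) :
    ∑ p ∈ (n + 1).primesLE, f p =
      ∑ p ∈ n.primesLE, f p + if (n + 1).Prime then f (n + 1) else 0 := by
  rw [Nat.primesLE_succ]
  split_ifs with h
  · rw [Finset.sum_insert (Nat.notMem_primesLE n), add_comm]
  · simp

lemma log_sub_two_le_sum_log_div {N : ℕ} (hN : 1 ≤ N) :
    log N - 2 ≤ ∑ p ∈ N.primesLE, log p / p := by
  have hN0 : (0 : ℝ) < N := by exact_mod_cast hN
  have h1 := (le_log_factorial hN).trans (log_factorial_le_mul_sum N)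
  have h2 : ∑ p ∈ N.primesLE, log p / ((p : ℝ) - 1) =
      ∑ p ∈ N.primesLE, log p / p + ∑ p ∈ N.primesLE, log p / ((p : ℝ) * (p - 1)) := by
    rw [← Finset.sum_add_distrib]
    refine Finset.sum_congr rfl fun p hp => ?_
    have hp1 : (1 : ℝ) < p := by exact_mod_cast Nat.one_lt_of_mem_primesLE hp
    have : (p : ℝ) - 1 ≠ 0 := by linarith
    field_simp
    ring
  have h3 := sum_primesLE_log_div_le_one N
  rw [h2] at h1
  have h4 : (N : ℝ) * (log N - 1) ≤ N * (∑ p ∈ N.primesLE, log p / p + 1) := by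
    refine le_trans (by linarith) (h1.trans ?_)
    gcongr
  have := le_of_mul_le_mul_left h4 hN0
  linarith

lemma sum_log_div_le {N : ℕ} (hN : 1 ≤ N) :
    ∑ p ∈ N.primesLE, log p / p ≤
      log N - 1 + (∑ p ∈ N.primesLE, log p + log N + 1) / N := by
  have hN0 : (0 : ℝ) < N := by exact_mod_cast hN
  have h := (mul_sum_log_div_le N).trans (add_le_add_left (log_factorial_le hN) _)
  refine le_of_mul_le_mul_left (h.trans_eq ?_) hN0
  field_simp
  ring

/-- A lower bound in Mertens' second theorem, relative to the value of the sum at `N`. -/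
lemma log_log_add_le_sum_one_div {N t : ℕ} (hN : 2 ≤ N) (ht : N ≤ t) :
    log (log (t + 1)) + (∑ p ∈ N.primesLE, 1 / (p : ℝ) - log (log N) -
      (1 + (∑ p ∈ N.primesLE, log p + log N + 3) / N) / log N) ≤
    ∑ p ∈ t.primesLE, 1 / (p : ℝ) := by
  have hN1 : (1 : ℝ) < N := by exact_mod_cast hN
  have hNt : (N : ℝ) ≤ t := by exact_mod_cast ht
  have hlN : 0 < log N := log_pos hN1
  have hlt : log N ≤ log t := log_le_log (by linarith) hNt
  have h := log_log_le_of_weighted_sum (P := fun n => ∑ p ∈ n.primesLE, 1 / (p : ℝ))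
    (A := fun n => ∑ p ∈ n.primesLE, log p / (p : ℝ))
    (K := log N + 1 + (∑ p ∈ N.primesLE, log p + log N + 1) / N) hN
    (fun n => by
      rw [sum_primesLE_succ, sum_primesLE_succ]
      split_ifs
      · push_cast; ring
      · simp)
    (fun n hn => by
      have h1 := log_sub_two_le_sum_log_div (N := n) (by omega)
      have h2 := sum_log_div_le (N := N) (by omega)
      linarith) ht
  have h2 : log (log ((t : ℝ) + 1)) ≤ log (log t) + 1 / N / log N := by
    have ht0 : (0 : ℝ) < t := by linarith
    have hlt0 : 0 < log t := hlN.trans_le hlt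
    have h3 : log ((t : ℝ) + 1) - log t ≤ 1 / t := by
      have h := log_le_sub_one_of_pos (x := ((t : ℝ) + 1) / t) (by positivity)
      rwa [log_div (by positivity) (by positivity), add_div, div_self ht0.ne',
        add_sub_cancel_left] at h
    have hlt1 : 0 < log ((t : ℝ) + 1) := log_pos (by linarith)
    have h4 := log_le_sub_one_of_pos (x := log ((t : ℝ) + 1) / log t) (by positivity)
    rw [log_div (by positivity) (by positivity)] at h4
    have h5 : log ((t : ℝ) + 1) / log t - 1 = (log ((t : ℝ) + 1) - log t) / log t := by
      rw [sub_div, div_self hlt0.ne']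
    have h6 : (log ((t : ℝ) + 1) - log t) / log t ≤ 1 / N / log N := by
      gcongr
      exact h3.trans (by gcongr)
    linarith
  refine le_trans ?_ h
  have h7 : (log N + 1 + (∑ p ∈ N.primesLE, log p + log N + 1) / N + 1 / N) / log N =
      1 + (1 + (∑ p ∈ N.primesLE, log p + log N + 3) / N) / log N - 1 / N / log N := by
    field_simp
    ring
  rw [h7]
  linarith

lemma integral_Ioi_log_mul_exp_neg :
    ∫ v in Set.Ioi (0 : ℝ), log v * exp (-v) = -eulerMascheroniConstant := by
  have h1 := Complex.hasDerivAt_GammaIntegral (s := 1) (by simp)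
  have h2 : Complex.GammaIntegral =ᶠ[nhds 1] Complex.Gamma := by
    have : {s : ℂ | 0 < s.re} ∈ nhds (1 : ℂ) :=
      (isOpen_lt continuous_const Complex.continuous_re).mem_nhds (by simp)
    filter_upwards [this] with s hs using (Complex.Gamma_eq_integral hs).symm
  have h3 := (Complex.hasDerivAt_Gamma_one.congr_of_eventuallyEq h2).unique h1
  have h4 : ∫ t : ℝ in Set.Ioi 0, (t : ℂ) ^ ((1 : ℂ) - 1) * (Real.log t * Real.exp (-t)) =
      ((∫ v in Set.Ioi (0 : ℝ), log v * exp (-v) : ℝ) : ℂ) := by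
    refine Eq.trans ?_ integral_complex_ofReal
    refine MeasureTheory.integral_congr_ae (Filter.Eventually.of_forall fun t => ?_)
    simp
  rw [h4] at h3
  exact_mod_cast h3.symm

lemma integrableOn_log_mul_exp_neg :
    MeasureTheory.IntegrableOn (fun v => log v * exp (-v)) (Set.Ioi 0) := by
  by_contra h
  have h1 := integral_Ioi_log_mul_exp_neg
  rw [MeasureTheory.integral_undef h] at h1
  linarith [one_half_lt_eulerMascheroniConstant]

open MeasureTheory in
lemma setIntegral_le_sum_one_div_mul_exp {κ δ : ℝ} {N : ℕ} (hN : 2 ≤ N) (hδ : 0 < δ)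
    (h : ∀ t : ℕ, N ≤ t → log (log (t + 1)) + κ ≤ ∑ p ∈ t.primesLE, 1 / (p : ℝ)) (V : ℝ) :
    ∫ v in Set.Ioc (δ * log N) V, (log v + (κ - log δ)) * exp (-v) ≤
      ∑ p ∈ ⌊exp (V / δ)⌋₊.primesLE, 1 / (p : ℝ) * exp (-(δ * log p)) := by
  have hN1 : (1 : ℝ) < N := by exact_mod_cast hN
  have hc0 : 0 < δ * log N := mul_pos hδ (log_pos hN1)
  set S := Set.Ioc (δ * log N) V with hS
  have hSsub : S ⊆ Set.Ioi 0 := fun v hv => hc0.trans hv.1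
  have hexp : ∀ c : ℝ, IntegrableOn (fun v => exp (-v)) (Set.Ici c) := fun c =>
    (integrableOn_Ici_iff_integrableOn_Ioi).2 (integrableOn_exp_neg_Ioi c)
  have hexpS : IntegrableOn (fun v => exp (-v)) S :=
    (integrableOn_exp_neg_Ioi 0).mono_set hSsub
  have h1 : ∀ p : ℕ, ∫ v in S, (Set.Ici (δ * log p)).indicator (fun v => exp (-v)) v ≤
      exp (-(δ * log p)) := by
    intro p
    rw [setIntegral_indicator measurableSet_Ici, ← integral_exp_neg_Ioi,
      ← integral_Ici_eq_integral_Ioi]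
    exact setIntegral_mono_set (hexp _) (Filter.Eventually.of_forall fun v => (exp_pos _).le)
      (Set.inter_subset_right.eventuallyLE)
  have hint : ∀ p : ℕ, IntegrableOn
      (fun v => 1 / (p : ℝ) * (Set.Ici (δ * log p)).indicator (fun v => exp (-v)) v) S := fun p =>
    (hexpS.indicator measurableSet_Ici).const_mul _
  calc ∫ v in S, (log v + (κ - log δ)) * exp (-v)
      ≤ ∫ v in S, ∑ p ∈ ⌊exp (V / δ)⌋₊.primesLE,
          1 / (p : ℝ) * (Set.Ici (δ * log p)).indicator (fun v => exp (-v)) v := by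
        refine setIntegral_mono_on ?_ (integrable_finsetSum _ fun p _ => hint p)
          measurableSet_Ioc ?_
        · simp_rw [add_mul]
          exact (integrableOn_log_mul_exp_neg.mono_set hSsub).add (hexpS.const_mul _)
        · intro v hv
          have hv0 : 0 < v := hSsub hv
          have hNv : (N : ℝ) < exp (v / δ) := by
            rw [← log_lt_iff_lt_exp (by linarith), lt_div_iff₀ hδ, mul_comm]
            exact hv.1
          have hm := h ⌊exp (v / δ)⌋₊ (Nat.le_floor hNv.le)
          have h2 : v / δ ≤ log ((⌊exp (v / δ)⌋₊ : ℝ) + 1) := by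
            rw [le_log_iff_exp_le (by positivity)]
            exact (Nat.lt_floor_add_one _).le
          have h3 : log v - log δ ≤ log (log ((⌊exp (v / δ)⌋₊ : ℝ) + 1)) := by
            rw [← log_div hv0.ne' hδ.ne']
            exact log_le_log (by positivity) h2
          have h4 : log v + (κ - log δ) ≤ ∑ p ∈ ⌊exp (v / δ)⌋₊.primesLE, 1 / (p : ℝ) := by
            linarith
          refine (mul_le_mul_of_nonneg_right h4 (exp_pos _).le).trans ?_
          rw [Finset.sum_mul]
          have hsub : ⌊exp (v / δ)⌋₊.primesLE ⊆ ⌊exp (V / δ)⌋₊.primesLE := by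
            apply Nat.primesLE_mono
            apply Nat.floor_mono
            have := hv.2
            gcongr
          refine le_trans ?_ (Finset.sum_le_sum_of_subset_of_nonneg hsub ?_)
          · refine Finset.sum_le_sum fun p hp => ?_
            rw [Set.indicator_of_mem]
            rw [Set.mem_Ici, mul_comm, ← le_div_iff₀ hδ,
              log_le_iff_le_exp (by exact_mod_cast (Nat.prime_of_mem_primesLE hp).pos)]
            exact (Nat.le_floor_iff (exp_pos _).le).1 (Nat.le_of_mem_primesLE hp)
          · intro p _ _
            exact mul_nonneg (by positivity)
              (Set.indicator_nonneg (fun _ _ => (exp_pos _).le) _)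
    _ = ∑ p ∈ ⌊exp (V / δ)⌋₊.primesLE, 1 / (p : ℝ) *
          ∫ v in S, (Set.Ici (δ * log p)).indicator (fun v => exp (-v)) v := by
        rw [integral_finsetSum _ fun p _ => hint p]
        exact Finset.sum_congr rfl fun p _ => integral_const_mul _ _
    _ ≤ _ := Finset.sum_le_sum fun p _ => mul_le_mul_of_nonneg_left (h1 p) (by positivity)

/-- Finite partial products of the Euler product are at most the zeta sum. -/
lemma sum_neg_log_one_sub_rpow_le {s : ℝ} (hs : 1 < s) (G : Finset ℕ) (hG : ∀ p ∈ G, p.Prime) :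
    ∑ p ∈ G, -log (1 - (p : ℝ) ^ (-s)) ≤ log (∑' n : ℕ, 1 / (n : ℝ) ^ s) := by
  let f : ℕ →*₀ ℝ :=
    { toFun := fun n => (n : ℝ) ^ (-s)
      map_zero' := by simp [zero_rpow (by linarith : -s ≠ 0)]
      map_one' := by simp
      map_mul' := fun m n => by
        push_cast
        exact mul_rpow m.cast_nonneg n.cast_nonneg }
  have hf : ∀ n, f n = (n : ℝ) ^ (-s) := fun _ => rfl
  have hf1 : ∀ n, f n = 1 / (n : ℝ) ^ s := fun n => by
    rw [hf, rpow_neg n.cast_nonneg, one_div]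
  have hsum : Summable (‖f ·‖) := by
    simp_rw [hf1]
    exact (summable_one_div_nat_rpow.2 hs).norm
  have hprod := EulerProduct.eulerProduct_completely_multiplicative hsum
  have hlt : ∀ p : ℕ, p.Prime → (p : ℝ) ^ (-s) < 1 := fun p hp =>
    rpow_lt_one_of_one_lt_of_neg (by exact_mod_cast hp.one_lt) (by linarith)
  have hZ : 0 < ∑' n, f n := by
    simp_rw [hf1]
    exact (summable_one_div_nat_rpow.2 hs).tsum_pos (fun n => by positivity) 1 (by simp)
  have hlog := hprod.log hZ.ne'
  simp_rw [← hf1]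
  refine ge_of_tendsto hlog ?_
  filter_upwards [Filter.eventually_gt_atTop (G.sup id)] with n hn
  have hpos : ∀ p ∈ n.primesBelow, 0 < 1 - f p := fun p hp => by
    linarith [hlt p (Nat.prime_of_mem_primesBelow hp), hf p]
  rw [log_prod fun p hp => (inv_pos.2 (hpos p hp)).ne']
  simp_rw [log_inv]
  refine Finset.sum_le_sum_of_subset_of_nonneg (fun p hp => ?_) fun p hp _ => ?_
  · exact Nat.mem_primesBelow.2 ⟨(Finset.le_sup (f := id) hp).trans_lt hn, hG p hp⟩
  · have h0 : 0 ≤ f p := by rw [hf]; positivity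
    exact neg_nonneg.2 (log_nonpos (hpos p hp).le (by linarith [hf p]))

open Filter Topology MeasureTheory in
/-- An eventual lower bound for the sum of reciprocals of primes bounds the constant of Mertens'
second theorem from below. -/
lemma add_sum_le_eulerMascheroniConstant {κ : ℝ} {N : ℕ} (hN : 2 ≤ N)
    (h : ∀ t : ℕ, N ≤ t → log (log (t + 1)) + κ ≤ ∑ p ∈ t.primesLE, 1 / (p : ℝ))
    (F : Finset ℕ) (hF : ∀ p ∈ F, p.Prime) :
    κ + ∑ p ∈ F, (-log (1 - (p : ℝ)⁻¹) - (p : ℝ)⁻¹) ≤ eulerMascheroniConstant := by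
  have hN1 : (1 : ℝ) < N := by exact_mod_cast hN
  set u := log N with hu
  have hu0 : 0 < u := log_pos hN1
  have hintκ : ∀ c : ℝ, IntegrableOn (fun v => (log v + c) * exp (-v)) (Set.Ioi 0) := by
    intro c
    simp_rw [add_mul]
    exact integrableOn_log_mul_exp_neg.add ((integrableOn_exp_neg_Ioi 0).const_mul _)
  have hcorr : ∀ x : ℝ, 0 ≤ x → x < 1 → 0 ≤ -log (1 - x) - x := by
    intro x _ hx1
    have := log_le_sub_one_of_pos (x := 1 - x) (by linarith)
    linarith
  have hfin : ∀ δ : ℝ, 0 < δ → ∀ V : ℝ,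
      ∫ v in Set.Ioc (δ * u) V, (log v + (κ - log δ)) * exp (-v) ≤
      log (∑' n : ℕ, 1 / (n : ℝ) ^ (1 + δ)) -
        ∑ p ∈ F, (-log (1 - (p : ℝ) ^ (-(1 + δ))) - (p : ℝ) ^ (-(1 + δ))) := by
    intro δ hδ V
    have hlt : ∀ p : ℕ, p.Prime → (p : ℝ) ^ (-(1 + δ)) < 1 := fun p hp =>
      rpow_lt_one_of_one_lt_of_neg (by exact_mod_cast hp.one_lt) (by linarith)
    refine (setIntegral_le_sum_one_div_mul_exp hN hδ h V).trans ?_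
    set G := ⌊exp (V / δ)⌋₊.primesLE with hGdef
    have hG : ∀ p ∈ G, p.Prime := fun p hp => Nat.prime_of_mem_primesLE hp
    have hGF : ∀ p ∈ G ∪ F, p.Prime := fun p hp => (Finset.mem_union.1 hp).elim (hG p) (hF p)
    have h1 := sum_neg_log_one_sub_rpow_le (s := 1 + δ) (by linarith) (G ∪ F) hGF
    have h2 : ∑ p ∈ G, 1 / (p : ℝ) * exp (-(δ * log p)) = ∑ p ∈ G, (p : ℝ) ^ (-(1 + δ)) := by
      refine Finset.sum_congr rfl fun p hp => ?_
      have hp0 : (0 : ℝ) < p := by exact_mod_cast (hG p hp).pos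
      rw [neg_add, rpow_add hp0, rpow_neg_one, one_div, rpow_def_of_pos hp0]
      congr 2
      ring
    have h3 : ∑ p ∈ G, (p : ℝ) ^ (-(1 + δ)) ≤ ∑ p ∈ G ∪ F, (p : ℝ) ^ (-(1 + δ)) :=
      Finset.sum_le_sum_of_subset_of_nonneg Finset.subset_union_left
        fun p _ _ => by positivity
    have h4 : ∑ p ∈ F, (-log (1 - (p : ℝ) ^ (-(1 + δ))) - (p : ℝ) ^ (-(1 + δ))) ≤
        ∑ p ∈ G ∪ F, (-log (1 - (p : ℝ) ^ (-(1 + δ))) - (p : ℝ) ^ (-(1 + δ))) :=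
      Finset.sum_le_sum_of_subset_of_nonneg Finset.subset_union_right
        fun p hp _ => hcorr _ (by positivity) (hlt p (hGF p hp))
    have h5 := Finset.sum_sub_distrib (s := G ∪ F) (fun p : ℕ => -log (1 - (p : ℝ) ^ (-(1 + δ))))
      fun p : ℕ => (p : ℝ) ^ (-(1 + δ))
    rw [h2]
    linarith
  have hinf : ∀ δ : ℝ, 0 < δ →
      ∫ v in Set.Ioi (δ * u), (log v + (κ - log δ)) * exp (-v) ≤
      log (∑' n : ℕ, 1 / (n : ℝ) ^ (1 + δ)) -
        ∑ p ∈ F, (-log (1 - (p : ℝ) ^ (-(1 + δ))) - (p : ℝ) ^ (-(1 + δ))) := by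
    intro δ hδ
    have hsub : Set.Ioi (δ * u) ⊆ Set.Ioi 0 := Set.Ioi_subset_Ioi (by positivity)
    refine le_of_tendsto (intervalIntegral_tendsto_integral_Ioi (δ * u)
      ((hintκ _).mono_set hsub) tendsto_id) ?_
    filter_upwards [eventually_ge_atTop (δ * u)] with V hV
    rw [id, intervalIntegral.integral_of_le hV]
    exact hfin δ hδ V
  have hmain : ∀ δ : ℝ, 0 < δ → δ < 1 →
      (∫ v in Set.Ioi (δ * u), (log v + κ) * exp (-v)) + u * (log δ * δ) ≤
      log (δ * ∑' n : ℕ, 1 / (n : ℝ) ^ (1 + δ)) -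
        ∑ p ∈ F, (-log (1 - (p : ℝ) ^ (-(1 + δ))) - (p : ℝ) ^ (-(1 + δ))) := by
    intro δ hδ hδ1
    have hsub : Set.Ioi (δ * u) ⊆ Set.Ioi 0 := Set.Ioi_subset_Ioi (by positivity)
    have h1 := hinf δ hδ
    have h2 : ∫ v in Set.Ioi (δ * u), (log v + (κ - log δ)) * exp (-v) =
        (∫ v in Set.Ioi (δ * u), (log v + κ) * exp (-v)) - log δ * exp (-(δ * u)) := by
      rw [← integral_exp_neg_Ioi, ← integral_const_mul, ← integral_sub
        ((hintκ _).mono_set hsub) ((integrableOn_exp_neg_Ioi _).const_mul _)]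
      congr 1
      ext v
      ring
    have hZ : 0 < ∑' n : ℕ, 1 / (n : ℝ) ^ (1 + δ) :=
      (summable_one_div_nat_rpow.2 (by linarith)).tsum_pos (fun n => by positivity) 1 (by simp)
    rw [log_mul hδ.ne' hZ.ne']
    have h3 : log δ ≤ 0 := log_nonpos hδ.le hδ1.le
    have h4 := add_one_le_exp (-(δ * u))
    nlinarith
  have hlim_left : Tendsto (fun δ : ℝ => (∫ v in Set.Ioi (δ * u), (log v + κ) * exp (-v)) +
      u * (log δ * δ)) (𝓝[>] 0) (𝓝 (-eulerMascheroniConstant + κ)) := by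
    have h1 : Tendsto (fun δ : ℝ => ∫ v in Set.Ioi (δ * u), (log v + κ) * exp (-v)) (𝓝[>] 0)
        (𝓝 (∫ v in Set.Ioi 0, (log v + κ) * exp (-v))) := by
      refine (hintκ κ).continuousWithinAt_Ici_primitive_Ioi.tendsto.comp
        (tendsto_nhdsWithin_iff.2 ⟨?_, ?_⟩)
      · have : Tendsto (fun δ : ℝ => δ * u) (𝓝 0) (𝓝 (0 * u)) := tendsto_id.mul_const u
        rw [zero_mul] at this
        exact this.mono_left nhdsWithin_le_nhds
      · filter_upwards [self_mem_nhdsWithin] with δ hδ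
        exact (mul_pos hδ hu0).le
    have h2 : ∫ v in Set.Ioi 0, (log v + κ) * exp (-v) = -eulerMascheroniConstant + κ := by
      simp_rw [add_mul]
      rw [integral_add integrableOn_log_mul_exp_neg ((integrableOn_exp_neg_Ioi 0).const_mul _),
        integral_Ioi_log_mul_exp_neg, integral_const_mul, integral_exp_neg_Ioi]
      simp
    have h3 := tendsto_log_mul_rpow_nhdsGT_zero one_pos
    simp_rw [rpow_one] at h3
    have h4 := h1.add (h3.const_mul u)
    rwa [h2, mul_zero, add_zero] at h4
  have hadd : Tendsto (fun δ : ℝ => 1 + δ) (𝓝[>] 0) (𝓝 1) := by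
    have : Tendsto (fun δ : ℝ => 1 + δ) (𝓝 0) (𝓝 (1 + 0)) := tendsto_id.const_add 1
    rw [add_zero] at this
    exact this.mono_left nhdsWithin_le_nhds
  have hlim_right : Tendsto (fun δ : ℝ => log (δ * ∑' n : ℕ, 1 / (n : ℝ) ^ (1 + δ)) -
      ∑ p ∈ F, (-log (1 - (p : ℝ) ^ (-(1 + δ))) - (p : ℝ) ^ (-(1 + δ)))) (𝓝[>] 0)
      (𝓝 (0 - ∑ p ∈ F, (-log (1 - (p : ℝ)⁻¹) - (p : ℝ)⁻¹))) := by
    refine Tendsto.sub ?_ (tendsto_finsetSum _ fun p hp => ?_)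
    · have h1 : Tendsto (fun δ : ℝ => 1 + δ) (𝓝[>] 0) (𝓝[>] 1) := by
        refine tendsto_nhdsWithin_iff.2 ⟨hadd, ?_⟩
        filter_upwards [self_mem_nhdsWithin] with δ hδ
        have : (0 : ℝ) < δ := hδ
        show (1 : ℝ) < 1 + δ
        linarith
      have h2 := (tendsto_sub_mul_tsum_nat_rpow.comp h1).log one_ne_zero
      rw [log_one] at h2
      refine h2.congr fun δ => ?_
      simp
    · have hp0 : (0 : ℝ) < p := by exact_mod_cast (hF p hp).pos
      have hp1 : (1 : ℝ) < p := by exact_mod_cast (hF p hp).one_lt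
      have h1 : Tendsto (fun δ : ℝ => (p : ℝ) ^ (-(1 + δ))) (𝓝[>] 0) (𝓝 (p : ℝ)⁻¹) := by
        have := (tendsto_const_nhds (x := (p : ℝ))).rpow hadd.neg (Or.inl hp0.ne')
        rwa [rpow_neg_one] at this
      have h2 : 1 - (p : ℝ)⁻¹ ≠ 0 := by
        have := inv_lt_one_of_one_lt₀ hp1
        linarith
      exact ((h1.const_sub 1).log h2).neg.sub h1
  have hfinal := le_of_tendsto_of_tendsto hlim_left hlim_right (by
    filter_upwards [Ioo_mem_nhdsGT (zero_lt_one' ℝ)] with δ hδ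
    exact hmain δ hδ.1 hδ.2)
  linarith

/-- An upper bound in Mertens' third theorem, in terms of Chebyshev's function. -/
lemma sum_log_div_sub_one_le {N : ℕ} (hN : 2 ≤ N) :
    ∑ p ∈ N.primesLE, log (p / (p - 1)) ≤ eulerMascheroniConstant + log (log N) +
      (1 + (∑ p ∈ N.primesLE, log p + log N + 3) / N) / log N := by
  have h := add_sum_le_eulerMascheroniConstant hN
    (fun t ht => log_log_add_le_sum_one_div hN ht) N.primesLE
    (fun p hp => Nat.prime_of_mem_primesLE hp)
  have h1 : ∑ p ∈ N.primesLE, (-log (1 - (p : ℝ)⁻¹) - (p : ℝ)⁻¹) =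
      ∑ p ∈ N.primesLE, log (p / (p - 1)) - ∑ p ∈ N.primesLE, 1 / (p : ℝ) := by
    rw [← Finset.sum_sub_distrib]
    refine Finset.sum_congr rfl fun p hp => ?_
    have hp1 : (1 : ℝ) < p := by exact_mod_cast Nat.one_lt_of_mem_primesLE hp
    rw [← log_inv, one_div]
    congr 2
    have : (p : ℝ) - 1 ≠ 0 := by linarith
    field_simp
  linarith

lemma one_div_le_log_div_sub_one {x : ℝ} (hx : 1 < x) : 1 / x ≤ log (x / (x - 1)) := by
  have h := one_sub_inv_le_log_of_pos (x := x / (x - 1)) (div_pos (by linarith) (by linarith))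
  refine le_trans (le_of_eq ?_) h
  field_simp
  ring

lemma log_div_sub_one_le_one_div {x : ℝ} (hx : 1 < x) : log (x / (x - 1)) ≤ 1 / (x - 1) := by
  have h := log_le_sub_one_of_pos (x := x / (x - 1)) (div_pos (by linarith) (by linarith))
  refine h.trans (le_of_eq ?_)
  have : x - 1 ≠ 0 := by linarith
  field_simp
  ring

/-- A prime outside the range of the Lagrangian bound does not contribute. -/
lemma log_div_sub_one_le_mul_log {p y : ℕ} (hy : 2 ≤ y) (h : y < p) :
    log (p / (p - 1)) ≤ 1 / (y * log y) * log p := by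
  have hy1 : (1 : ℝ) < y := by exact_mod_cast hy
  have hp : (y : ℝ) + 1 ≤ p := by exact_mod_cast h
  have hl : 0 < log y := log_pos hy1
  have hly : log y ≤ log p := log_le_log (by linarith) (by linarith)
  calc log ((p : ℝ) / (p - 1)) ≤ 1 / (p - 1) := log_div_sub_one_le_one_div (by linarith)
    _ ≤ 1 / y := by gcongr; linarith
    _ = 1 / (y * log y) * log y := by field_simp
    _ ≤ _ := by gcongr

lemma mul_log_le_log_div_sub_one {p y : ℕ} (hp : 2 ≤ p) (h : p ≤ y) :
    1 / (y * log y) * log p ≤ log (p / (p - 1)) := by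
  have hp1 : (1 : ℝ) < p := by exact_mod_cast hp
  have hy : (p : ℝ) ≤ y := by exact_mod_cast h
  have hl : 0 < log p := log_pos hp1
  have hly : log p ≤ log y := log_le_log (by linarith) hy
  calc 1 / (y * log y) * log p ≤ 1 / (p * log p) * log p := by gcongr
    _ = 1 / p := by field_simp
    _ ≤ _ := one_div_le_log_div_sub_one hp1

lemma logAbundancy_le_mul_add {p : ℕ} (hp : p.Prime) {c : ℝ} (hc : 0 ≤ c)
    (h : c * log p ≤ log (p / (p - 1))) (a : ℕ) :
    logAbundancy p a ≤ c * (a * log p) + (log (p / (p - 1)) - c * log p) := by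
  rcases Nat.eq_zero_or_pos a with rfl | ha
  · simp [logAbundancy, h]
  · have h1 := logAbundancy_le hp a
    have h2 : (1 : ℝ) ≤ a := by exact_mod_cast ha
    have h3 : c * log p ≤ c * (a * log p) := by
      have := log_natCast_nonneg p
      gcongr
      nlinarith
    linarith

lemma log_five_div_four_le {q : ℕ} (hq : 2 ≤ q) (hq5 : q ≤ 5) :
    log (5 / 4) ≤ log ((q : ℝ) / (q - 1)) := by
  have h1 : (2 : ℝ) ≤ q := by exact_mod_cast hq
  have h2 : (q : ℝ) ≤ 5 := by exact_mod_cast hq5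
  apply log_le_log (by norm_num)
  rw [div_le_div_iff₀ (by norm_num) (by linarith)]
  linarith

lemma robinInequality_of_log_lt {n : ℕ} (hn : 1 < log n)
    (h : log (ArithmeticFunction.sigma 1 n) <
      log n + eulerMascheroniConstant + log (log (log n))) : RobinInequality n := by
  have hn0 : n ≠ 0 := by rintro rfl; norm_num at hn
  have hs : (0 : ℝ) < ArithmeticFunction.sigma 1 n := by
    exact_mod_cast ArithmeticFunction.sigma_pos 1 n hn0
  rw [RobinInequality, ← exp_log hs]
  refine (exp_lt_exp.2 h).trans_eq ?_
  rw [exp_add, exp_add, exp_log (by positivity), exp_log (log_pos hn)]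
  ring

lemma robinInequality_of_le_log {n q : ℕ} (hn : 9000 ≤ log n) (hq : q.Prime) (hq5 : q ≤ 5)
    (hqn : ¬ q ∣ n) : RobinInequality n := by
  apply robinInequality_of_log_lt (by linarith)
  set N := ⌊log n⌋₊ with hN
  have hN9 : 9000 ≤ N := Nat.le_floor (by exact_mod_cast hn)
  have hNr : (9000 : ℝ) ≤ N := by exact_mod_cast hN9
  have hNle : (N : ℝ) ≤ log n := Nat.floor_le (by linarith)
  have hltN : log n ≤ N + 1 := (Nat.lt_floor_add_one _).le
  have hn0 : n ≠ 0 := by rintro rfl; norm_num at hn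
  set L := log (N : ℝ) with hL
  have hL9 : 9.1 ≤ L := by
    have h1 : ((91 : ℕ) / (10 : ℕ) : ℝ) ≤ log (9000 : ℕ) :=
      le_log_of_pow_le (by norm_num) (by norm_num) (by decide +kernel)
    have h2 : log (9000 : ℕ) ≤ L := log_le_log (by norm_num) (by exact_mod_cast hN9)
    norm_num at *
    linarith
  have hL0 : 0 < L := by linarith
  set c : ℝ := 1 / (N * L) with hc
  have hc0 : 0 < c := by positivity
  have hqT : q ∈ N.primesLE := Nat.mem_primesLE.2 ⟨by omega, hq⟩
  have hT := sum_log_div_sub_one_le (N := N) (by omega)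
  have hmain := log_sigma_one_le hn0 hqn (c := c) (fun p => log (p / (p - 1)) - c * log p)
    N.primesLE
    (fun p hp hpT => log_div_sub_one_le_mul_log (by omega) (by
      by_contra! hle
      exact hpT (Nat.mem_primesLE.2 ⟨hle, hp⟩)))
    (fun p hp => sub_nonneg.2 (mul_log_le_log_div_sub_one (Nat.one_lt_of_mem_primesLE hp)
      (Nat.le_of_mem_primesLE hp)))
    (fun p hp hpp => logAbundancy_le_mul_add hpp hc0.le (mul_log_le_log_div_sub_one
      (Nat.one_lt_of_mem_primesLE hp) (Nat.le_of_mem_primesLE hp)))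
  rw [Finset.sum_erase_eq_sub hqT, Finset.sum_sub_distrib, ← Finset.mul_sum] at hmain
  have hlog54 : (223 / 1000 : ℝ) ≤ log (5 / 4) := by
    rw [le_log_iff_exp_le (by norm_num)]
    have h1 := exp_bound' (x := 223 / 1000) (by norm_num) (by norm_num) (n := 6) (by norm_num)
    refine h1.trans ?_
    norm_num [Finset.sum_range_succ, Nat.factorial]
  have hgq := log_five_div_four_le hq.two_le hq5
  have hlq : log q ≤ 2 := by
    have h1 : log (q : ℝ) ≤ log (5 : ℕ) :=
      log_le_log (by exact_mod_cast hq.pos) (by exact_mod_cast hq5)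
    have h2 : log (5 : ℕ) ≤ ((2 : ℕ) : ℝ) / (1 : ℕ) :=
      log_le_of_pow_le (by norm_num) (by norm_num) (by decide +kernel)
    norm_num at h1 h2
    linarith
  have hll : log L ≤ log (log (log n)) :=
    log_le_log hL0 (log_le_log (by linarith) hNle)
  have h1 : (1 + (∑ p ∈ N.primesLE, log p + L + 3) / N) / L =
      1 / L + c * ∑ p ∈ N.primesLE, log p + 1 / N + 3 * c := by
    rw [hc]
    field_simp
    ring
  have h2 : c * N = 1 / L := by
    rw [hc]
    field_simp
  have h3 : 1 / L ≤ 10 / 91 := by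
    rw [div_le_div_iff₀ hL0 (by norm_num)]
    linarith
  have h4 : 1 / (N : ℝ) ≤ 1 / 9000 := by gcongr
  have h5 : c ≤ 1 / 9000 := by
    rw [hc]
    gcongr
    nlinarith
  have h6 : c * log q ≤ c * 2 := by gcongr
  have h7 : c * log n ≤ c * (N + 1) := by gcongr
  rw [← hL, h1] at hT
  rw [mul_add, h2] at h7
  linarith

lemma logAbundancy_succ_sub {p : ℕ} (hp : p.Prime) (a : ℕ) :
    logAbundancy p (a + 1) - logAbundancy p a =
      log (1 + 1 / (p * (ArithmeticFunction.sigma 1 (p ^ a) : ℝ))) := by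
  have hp0 : (0 : ℝ) < p := by exact_mod_cast hp.pos
  have hs : ∀ a, (0 : ℝ) < ArithmeticFunction.sigma 1 (p ^ a) := fun a => by
    exact_mod_cast ArithmeticFunction.sigma_pos 1 _ (pow_pos hp.pos a).ne'
  have h1 : (ArithmeticFunction.sigma 1 (p ^ (a + 1)) : ℝ) =
      p * ArithmeticFunction.sigma 1 (p ^ a) + 1 := by
    rw [ArithmeticFunction.sigma_one_apply_prime_pow hp,
      ArithmeticFunction.sigma_one_apply_prime_pow hp]
    exact_mod_cast geom_sum_succ
  have h2 : 1 + 1 / (p * (ArithmeticFunction.sigma 1 (p ^ a) : ℝ)) =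
      ArithmeticFunction.sigma 1 (p ^ (a + 1)) / (p * ArithmeticFunction.sigma 1 (p ^ a)) := by
    have := hs a
    rw [h1]
    field_simp
  rw [h2, log_div (hs _).ne' (mul_pos hp0 (hs a)).ne', log_mul hp0.ne' (hs a).ne',
    logAbundancy, logAbundancy]
  push_cast
  ring

/-- The exponent maximizing the Lagrangian at a prime. -/
lemma logAbundancy_sub_le_sub {p A : ℕ} (hp : p.Prime) {c : ℝ}
    (h1 : c * log p * ArithmeticFunction.sigma 1 (p ^ A) ≤ 1)
    (h2 : 1 ≤ c * log p * (p * ArithmeticFunction.sigma 1 (p ^ A))) (a : ℕ) :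
    logAbundancy p a - c * (a * log p) ≤ logAbundancy p A - c * (A * log p) := by
  have hp0 : (0 : ℝ) < p := by exact_mod_cast hp.pos
  have hs : ∀ a, (0 : ℝ) < ArithmeticFunction.sigma 1 (p ^ a) := fun a => by
    exact_mod_cast ArithmeticFunction.sigma_pos 1 _ (pow_pos hp.pos a).ne'
  have hmono : ∀ a b, a ≤ b → (ArithmeticFunction.sigma 1 (p ^ a) : ℝ) ≤
      ArithmeticFunction.sigma 1 (p ^ b) := fun a b hab => by
    rw [ArithmeticFunction.sigma_one_apply_prime_pow hp,
      ArithmeticFunction.sigma_one_apply_prime_pow hp]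
    exact_mod_cast Finset.sum_le_sum_of_subset (Finset.range_subset_range.2 (by omega))
  have hsucc : ∀ a, (ArithmeticFunction.sigma 1 (p ^ (a + 1)) : ℝ) =
      p * ArithmeticFunction.sigma 1 (p ^ a) + 1 := fun a => by
    rw [ArithmeticFunction.sigma_one_apply_prime_pow hp,
      ArithmeticFunction.sigma_one_apply_prime_pow hp]
    exact_mod_cast geom_sum_succ
  have hup : ∀ b, A ≤ b →
      logAbundancy p (b + 1) - c * ((b + 1 : ℕ) * log p) ≤ logAbundancy p b - c * (b * log p) := by
    intro b hb
    have h3 := logAbundancy_succ_sub hp b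
    have h4 : 0 < p * (ArithmeticFunction.sigma 1 (p ^ b) : ℝ) := mul_pos hp0 (hs b)
    have h5 := log_le_sub_one_of_pos
      (x := 1 + 1 / (p * (ArithmeticFunction.sigma 1 (p ^ b) : ℝ))) (by positivity)
    have h7 : 1 / (p * (ArithmeticFunction.sigma 1 (p ^ A) : ℝ)) ≤ c * log p := by
      rwa [div_le_iff₀ (mul_pos hp0 (hs A))]
    have h8 : 1 / (p * (ArithmeticFunction.sigma 1 (p ^ b) : ℝ)) ≤
        1 / (p * (ArithmeticFunction.sigma 1 (p ^ A) : ℝ)) :=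
      one_div_le_one_div_of_le (mul_pos hp0 (hs A))
        (mul_le_mul_of_nonneg_left (hmono _ _ hb) hp0.le)
    push_cast
    linarith
  have hlow : ∀ b < A,
      logAbundancy p b - c * (b * log p) ≤ logAbundancy p (b + 1) - c * ((b + 1 : ℕ) * log p) := by
    intro b hb
    have h3 := logAbundancy_succ_sub hp b
    have h4 : 0 < p * (ArithmeticFunction.sigma 1 (p ^ b) : ℝ) := mul_pos hp0 (hs b)
    have h5 := one_sub_inv_le_log_of_pos
      (x := 1 + 1 / (p * (ArithmeticFunction.sigma 1 (p ^ b) : ℝ))) (by positivity)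
    have h6 : 1 - (1 + 1 / (p * (ArithmeticFunction.sigma 1 (p ^ b) : ℝ)))⁻¹ =
        1 / ArithmeticFunction.sigma 1 (p ^ (b + 1)) := by
      rw [hsucc]
      have := (hs b).ne'
      field_simp
      ring
    have h7 : c * log p ≤ 1 / ArithmeticFunction.sigma 1 (p ^ A) := by
      rwa [le_div_iff₀ (hs A)]
    have h8 : 1 / (ArithmeticFunction.sigma 1 (p ^ A) : ℝ) ≤
        1 / ArithmeticFunction.sigma 1 (p ^ (b + 1)) :=
      one_div_le_one_div_of_le (hs _) (hmono _ _ hb)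
    push_cast
    linarith
  rcases le_total a A with h | h
  · induction h using Nat.decreasingInduction with
    | self => exact le_rfl
    | of_succ b hb ih => exact (hlow b hb).trans ih
  · induction a, h using Nat.le_induction with
    | base => exact le_rfl
    | succ b hb ih => exact (hup b hb).trans ih

/-- The product of the primes below `100`. -/
def sieveModulus : ℕ := 2305567963945518424753102147331756070

/-- A quickly computable superset of the primes that are at least `5`. -/
def passesSieve (m : ℕ) : Bool :=
  m == 5 || m == 7 || (m.gcd 210 == 1 && (Nat.blt m 121 || m.gcd sieveModulus == 1))

lemma passesSieve_of_prime {p : ℕ} (hp : p.Prime) (h5 : 5 ≤ p) : passesSieve p = true := by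
  have hK : sieveModulus ∣ Nat.factorial 97 := by decide +kernel
  have h7 : 210 ∣ Nat.factorial 7 := by decide
  simp only [passesSieve, Bool.or_eq_true, Bool.and_eq_true, beq_iff_eq, Nat.blt_eq]
  by_cases h : p ∣ 210
  · have : p ≤ 7 := hp.dvd_factorial.1 (h.trans h7)
    interval_cases p
    · simp
    · exact absurd hp (by decide)
    · simp
  · refine Or.inr ⟨(hp.coprime_iff_not_dvd).2 h, ?_⟩
    by_cases h' : p ∣ sieveModulus
    · have : p ≤ 97 := hp.dvd_factorial.1 (h'.trans hK)
      omega
    · exact Or.inr ((hp.coprime_iff_not_dvd).2 h')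

/-- The product of `f` over `2 ^ k` consecutive numbers, by bisection. -/
def dyadicProd (f : ℕ → ℕ) : ℕ → ℕ → ℕ
  | 0, l => f l
  | k + 1, l => dyadicProd f k l * dyadicProd f k (l + 2 ^ k)

lemma dyadicProd_eq (f : ℕ → ℕ) (k l : ℕ) :
    dyadicProd f k l = ∏ m ∈ Finset.Ico l (l + 2 ^ k), f m := by
  induction k generalizing l with
  | zero => simp [dyadicProd]
  | succ k ih =>
    rw [dyadicProd, ih, ih, Finset.prod_Ico_consecutive _ (Nat.le_add_right _ _)
      (Nat.le_add_right _ _), add_assoc, ← two_mul, pow_succ']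

/-- The numbers from `5` to `y` that pass the sieve. -/
def sieved (y : ℕ) : Finset ℕ := (Finset.Icc 5 y).filter fun m => passesSieve m = true

/-- The product of `m - d` over the sieved numbers `m`. -/
def sievedProd (d y : ℕ) : ℕ :=
  dyadicProd (fun m => bif Nat.ble 5 m && Nat.ble m y && passesSieve m then m - d else 1)
    (y.log2 + 1) 0

lemma sievedProd_eq (d y : ℕ) : sievedProd d y = ∏ m ∈ sieved y, (m - d) := by
  have hy : y < 2 ^ (y.log2 + 1) := Nat.lt_log2_self
  have h : sieved y = (Finset.Ico 0 (0 + 2 ^ (y.log2 + 1))).filter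
      fun m => (Nat.ble 5 m && Nat.ble m y && passesSieve m) = true := by
    ext m
    simp only [sieved, Finset.mem_filter, Finset.mem_Icc, Finset.mem_Ico, Bool.and_eq_true,
      Nat.ble_eq]
    constructor
    · rintro ⟨⟨h1, h2⟩, h3⟩
      exact ⟨by omega, ⟨h1, h2⟩, h3⟩
    · rintro ⟨-, ⟨h1, h2⟩, h3⟩
      exact ⟨⟨h1, h2⟩, h3⟩
  rw [sievedProd, dyadicProd_eq, h, Finset.prod_filter]
  refine Finset.prod_congr rfl fun m _ => ?_
  cases Nat.ble 5 m && Nat.ble m y && passesSieve m <;> simp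

lemma log_sub_log_le_eulerMascheroniConstant : log 1770 - log 1000 ≤ eulerMascheroniConstant := by
  have h1 := eulerMascheroniSeq_lt_eulerMascheroniConstant 99
  have h2 : (5177 / 1000 : ℚ) ≤ harmonic 99 := by decide +kernel
  have h3 : log (100 : ℕ) ≤ (4606 : ℕ) / (1000 : ℕ) :=
    log_le_of_pow_le (by norm_num) (by norm_num) (by decide +kernel)
  have h4 : (571 / 1000 : ℝ) ≤ eulerMascheroniConstant := by
    have h5 : ((5177 / 1000 : ℚ) : ℝ) ≤ (harmonic 99 : ℝ) := by exact_mod_cast h2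
    rw [eulerMascheroniSeq] at h1
    norm_num at h1 h3 h5
    linarith
  have h6 : log (177 / 100) ≤ (571 / 1000 : ℝ) := by
    rw [log_le_iff_le_exp (by norm_num)]
    refine le_trans ?_ (sum_le_exp_of_nonneg (by norm_num) 8)
    norm_num [Finset.sum_range_succ, Nat.factorial]
  rw [← log_div (by norm_num) (by norm_num)]
  norm_num at *
  linarith

lemma sum_sieved_eq {c : ℝ} (y : ℕ) :
    ∑ m ∈ sieved y, (log (m / (m - 1)) - c * log m) =
      log (sievedProd 0 y) - log (sievedProd 1 y) - c * log (sievedProd 0 y) := by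
  have h5 : ∀ m ∈ sieved y, (5 : ℝ) ≤ m := fun m hm => by
    exact_mod_cast (Finset.mem_Icc.1 (Finset.mem_filter.1 hm).1).1
  have h0 : log (sievedProd 0 y) = ∑ m ∈ sieved y, log (m : ℝ) := by
    rw [sievedProd_eq, Nat.cast_prod, log_prod fun m hm => ?_]
    · simp
    · have := h5 m hm
      simp only [Nat.sub_zero]
      positivity
  have h1 : log (sievedProd 1 y) = ∑ m ∈ sieved y, log ((m : ℝ) - 1) := by
    rw [sievedProd_eq, Nat.cast_prod, log_prod fun m hm => ?_]
    · refine Finset.sum_congr rfl fun m hm => ?_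
      have : 5 ≤ m := by exact_mod_cast h5 m hm
      rw [Nat.cast_sub (by omega), Nat.cast_one]
    · have : 5 ≤ m := by exact_mod_cast h5 m hm
      exact_mod_cast (by omega : m - 1 ≠ 0)
  rw [h0, h1, Finset.mul_sum, ← Finset.sum_sub_distrib, ← Finset.sum_sub_distrib]
  refine Finset.sum_congr rfl fun m hm => ?_
  have := h5 m hm
  rw [log_div (by positivity) (by linarith)]

lemma sievedProd_pos {d y : ℕ} (hd : d < 5) : 0 < sievedProd d y := by
  rw [sievedProd_eq]
  refine Finset.prod_pos fun m hm => ?_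
  have := (Finset.mem_Icc.1 (Finset.mem_filter.1 hm).1).1
  omega

lemma mul_log_le_mul_log_of_pow_le {p s t y : ℕ} (hp : 0 < p) (h : p ^ s ≤ y ^ t) :
    s * log p ≤ t * log y := by
  rw [← log_pow, ← log_pow]
  exact log_le_log (by positivity) (by exact_mod_cast h)

/-- The Lagrangian bound with the sieved numbers up to `y` in place of the primes. -/
lemma log_sigma_one_le_of_sieve {n q y A₂ A₃ : ℕ} (hn : n ≠ 0) (hq : q.Prime) (hq5 : q ≤ 5)
    (hqn : ¬ q ∣ n) (hy : 5 ≤ y)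
    (h2 : 2 ^ ArithmeticFunction.sigma 1 (2 ^ A₂) ≤ y ^ y)
    (h2' : y ^ y ≤ 2 ^ (2 * ArithmeticFunction.sigma 1 (2 ^ A₂)))
    (h3 : 3 ^ ArithmeticFunction.sigma 1 (3 ^ A₃) ≤ y ^ y)
    (h3' : y ^ y ≤ 3 ^ (3 * ArithmeticFunction.sigma 1 (3 ^ A₃))) :
    log (ArithmeticFunction.sigma 1 n) ≤ log n + 1 / (y * log y) *
        (log n + log 5 - (A₂ * log 2 + A₃ * log 3 + log (sievedProd 0 y))) - log (5 / 4) +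
      (log (ArithmeticFunction.sigma 1 (2 ^ A₂)) + log (ArithmeticFunction.sigma 1 (3 ^ A₃)) +
        log (sievedProd 0 y)) - (A₂ * log 2 + A₃ * log 3 + log (sievedProd 1 y)) := by
  have hy1 : (1 : ℝ) < y := by exact_mod_cast (by omega : 1 < y)
  have hL : 0 < log (y : ℝ) := log_pos hy1
  set c : ℝ := 1 / (y * log y) with hc
  have hc0 : 0 < c := by positivity
  have hcle : ∀ p s : ℕ, 0 < p → p ^ s ≤ y ^ y → c * log p * s ≤ 1 := fun p s hp h => by
    have := mul_log_le_mul_log_of_pow_le hp h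
    rw [hc, mul_assoc, one_div_mul_eq_div, div_le_one (by positivity), mul_comm]
    exact this
  have hcge : ∀ p s : ℕ, y ^ y ≤ p ^ (p * s) → 1 ≤ c * log p * (p * s) := fun p s h => by
    have := mul_log_le_mul_log_of_pow_le (by omega) h
    rw [hc, mul_assoc, one_div_mul_eq_div, one_le_div (by positivity), mul_comm (log (p : ℝ))]
    exact_mod_cast this
  have hF : ∀ p A : ℕ, p.Prime → p ^ ArithmeticFunction.sigma 1 (p ^ A) ≤ y ^ y →
      y ^ y ≤ p ^ (p * ArithmeticFunction.sigma 1 (p ^ A)) → ∀ a : ℕ,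
      logAbundancy p a - c * (a * log p) ≤ logAbundancy p A - c * (A * log p) :=
    fun p A hp h h' a => logAbundancy_sub_le_sub hp (hcle p _ hp.pos h) (hcge p _ h') a
  have hF2 := hF 2 A₂ Nat.prime_two h2 h2'
  have hF3 := hF 3 A₃ Nat.prime_three h3 h3'
  let g : ℕ → ℝ := fun p => if p = 2 then logAbundancy 2 A₂ - c * (A₂ * log 2)
    else if p = 3 then logAbundancy 3 A₃ - c * (A₃ * log 3)
    else log (p / (p - 1)) - c * log p
  have hg2 : g 2 = logAbundancy 2 A₂ - c * (A₂ * log 2) := rfl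
  have hg3 : g 3 = logAbundancy 3 A₃ - c * (A₃ * log 3) := rfl
  have hg : ∀ m, 5 ≤ m → g m = log (m / (m - 1)) - c * log m := fun m hm => by
    simp only [g, if_neg (by omega : m ≠ 2), if_neg (by omega : m ≠ 3)]
  have hS : ∀ m ∈ sieved y, 5 ≤ m ∧ m ≤ y := fun m hm =>
    Finset.mem_Icc.1 (Finset.mem_filter.1 hm).1
  have hT : ∀ p : ℕ, p.Prime → p ≤ y → p ∈ insert 2 (insert 3 (sieved y)) := by
    intro p hp hpy
    rw [Finset.mem_insert, Finset.mem_insert, sieved, Finset.mem_filter, Finset.mem_Icc]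
    by_cases h5 : 5 ≤ p
    · exact Or.inr (Or.inr ⟨⟨h5, hpy⟩, passesSieve_of_prime hp h5⟩)
    · have := hp.two_le
      interval_cases p
      · simp
      · simp
      · exact absurd hp (by decide)
  have hab : ∀ p, p.Prime → logAbundancy p 1 = log (p + 1) - log p := fun p hp => by
    rw [logAbundancy, ArithmeticFunction.sigma_one_apply_prime_pow hp]
    simp [Finset.sum_range_succ, add_comm]
  have hgq : log (5 / 4) - c * log 5 ≤ g q := by
    have hq2 := hq.two_le
    have hcl : ∀ r : ℝ, 0 < r → r ≤ 5 → c * log r ≤ c * log 5 := fun r h h' => by gcongr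
    interval_cases q
    · have h := hF2 1
      rw [hab 2 Nat.prime_two] at h
      have h1 := hcl 2 (by norm_num) (by norm_num)
      have h4 : log (5 / 4) ≤ log (3 / 2) := log_le_log (by norm_num) (by norm_num)
      rw [log_div (x := 3) (by norm_num) (by norm_num)] at h4
      rw [hg2]
      norm_num at h
      linarith
    · have h := hF3 1
      rw [hab 3 Nat.prime_three] at h
      have h1 := hcl 3 (by norm_num) (by norm_num)
      have h4 : log (5 / 4) ≤ log (4 / 3) := log_le_log (by norm_num) (by norm_num)
      rw [log_div (x := 4) (by norm_num) (by norm_num)] at h4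
      rw [hg3]
      norm_num at h
      linarith
    · exact absurd hq (by decide)
    · rw [hg 5 le_rfl]
      norm_num
  have hmain := log_sigma_one_le hn hqn (c := c) g (insert 2 (insert 3 (sieved y)))
    (fun p hp hpT => log_div_sub_one_le_mul_log (by omega) (by
      by_contra! hle
      exact hpT (hT p hp hle)))
    (fun p hp => by
      rcases Finset.mem_insert.1 hp with rfl | hp
      · have := hF2 0
        rw [hg2]
        norm_num [logAbundancy] at *
        linarith
      rcases Finset.mem_insert.1 hp with rfl | hp
      · have := hF3 0
        rw [hg3]
        norm_num [logAbundancy] at *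
        linarith
      obtain ⟨h5, hpy⟩ := hS p hp
      rw [hg p h5]
      exact sub_nonneg.2 (mul_log_le_log_div_sub_one (by omega) hpy))
    (fun p hp hpp a => by
      rcases Finset.mem_insert.1 hp with rfl | hp
      · have := hF2 a
        rw [hg2]
        push_cast at *
        linarith
      rcases Finset.mem_insert.1 hp with rfl | hp
      · have := hF3 a
        rw [hg3]
        push_cast at *
        linarith
      obtain ⟨h5, hpy⟩ := hS p hp
      rw [hg p h5]
      exact logAbundancy_le_mul_add hpp hc0.le (mul_log_le_log_div_sub_one (by omega) hpy) a)
  rw [Finset.sum_erase_eq_sub (hT q hq (hq5.trans hy)), Finset.sum_insert (fun h => by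
      rcases Finset.mem_insert.1 h with h | h
      · omega
      · have := hS 2 h
        omega), Finset.sum_insert (fun h => by
      have := hS 3 h
      omega), Finset.sum_congr rfl fun m hm => hg m (hS m hm).1, sum_sieved_eq, hg2, hg3,
    logAbundancy, logAbundancy] at hmain
  push_cast at hmain
  linarith

/-- Robin's inequality for `a / 10 ≤ log n ≤ b / 10`, from comparisons of integers. -/
lemma robinInequality_of_mem_Icc {n q a b : ℕ} (hq : q.Prime) (hq5 : q ≤ 5) (hqn : ¬ q ∣ n)
    (ha : (a / 10 : ℝ) ≤ log n) (hb : log n ≤ b / 10) (y A₂ A₃ m R k : ℕ)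
    (h : (5 ≤ y ∧ 10 < a ∧ 0 < k ∧ 0 < R) ∧
      (2 ^ (∑ i ∈ Finset.range (A₂ + 1), 2 ^ i) ≤ y ^ y ∧
        y ^ y ≤ 2 ^ (2 * ∑ i ∈ Finset.range (A₂ + 1), 2 ^ i)) ∧
      (3 ^ (∑ i ∈ Finset.range (A₃ + 1), 3 ^ i) ≤ y ^ y ∧
        y ^ y ≤ 3 ^ (3 * ∑ i ∈ Finset.range (A₃ + 1), 3 ^ i)) ∧
      5 ^ 10 * 27182818286 ^ b ≤
        (2 ^ A₂ * 3 ^ A₃ * sievedProd 0 y) ^ 10 * y ^ m * 10000000000 ^ b ∧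
      27182818286 ^ m * 1000 ^ (10 * y) ≤ R ^ (10 * y) * 10000000000 ^ m ∧
      27182818286 ^ k * 10 ^ 100 ≤ a ^ 100 * 10000000000 ^ k ∧
      4 * (∑ i ∈ Finset.range (A₂ + 1), 2 ^ i) * (∑ i ∈ Finset.range (A₃ + 1), 3 ^ i) *
        sievedProd 0 y * R * 100 < 5 * 2 ^ A₂ * 3 ^ A₃ * sievedProd 1 y * 1770 * k) :
    RobinInequality n := by
  obtain ⟨⟨hy5, ha10, hk0, hR0⟩, h2, h3, hD, hR, hk, hP⟩ := h
  rw [← ArithmeticFunction.sigma_one_apply_prime_pow Nat.prime_two] at h2 hP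
  rw [← ArithmeticFunction.sigma_one_apply_prime_pow Nat.prime_three] at h3 hP
  have ha10' : (10 : ℝ) < a := by exact_mod_cast ha10
  have hlogn : 1 < log n := by linarith
  have hn : n ≠ 0 := by rintro rfl; norm_num at hlogn
  apply robinInequality_of_log_lt hlogn
  have hmain := log_sigma_one_le_of_sieve hn hq hq5 hqn hy5 h2.1 h2.2 h3.1 h3.2
  have hs2 : 0 < ArithmeticFunction.sigma 1 (2 ^ A₂) :=
    ArithmeticFunction.sigma_pos 1 _ (by positivity)
  have hs3 : 0 < ArithmeticFunction.sigma 1 (3 ^ A₃) :=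
    ArithmeticFunction.sigma_pos 1 _ (by positivity)
  have hM0 : 0 < sievedProd 0 y := sievedProd_pos (by norm_num)
  have hM1 : 0 < sievedProd 1 y := sievedProd_pos (by norm_num)
  have hDl := add_mul_log_le_log (by norm_num) (by positivity) ((mul_comm _ _).trans_le hD)
  have hRl := add_mul_log_le_log (by norm_num) (by positivity) hR
  have hkl := add_mul_log_le_log (by norm_num) (by positivity) hk
  have hPl : log ((4 * ArithmeticFunction.sigma 1 (2 ^ A₂) * ArithmeticFunction.sigma 1 (3 ^ A₃) *
      sievedProd 0 y * R * 100 : ℕ) : ℝ) <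
      log ((5 * 2 ^ A₂ * 3 ^ A₃ * sievedProd 1 y * 1770 * k : ℕ) : ℝ) :=
    log_lt_log (by exact_mod_cast (by positivity)) (by exact_mod_cast hP)
  generalize ArithmeticFunction.sigma 1 (2 ^ A₂) = s2 at *
  generalize ArithmeticFunction.sigma 1 (3 ^ A₃) = s3 at *
  generalize sievedProd 0 y = M0 at *
  generalize sievedProd 1 y = M1 at *
  have hy0 : (0 : ℝ) < y := by exact_mod_cast (by omega : 0 < y)
  have hL : 0 < log (y : ℝ) := log_pos (by exact_mod_cast (by omega : 1 < y))
  push_cast at hDl hRl hkl hPl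
  rw [log_mul (by positivity) (by positivity), log_pow,
    log_mul (by positivity) (by positivity), log_mul (by positivity) (by positivity),
    log_pow, log_pow, log_pow] at hDl
  rw [log_pow] at hRl hkl
  rw [log_mul (by positivity) (by positivity), log_mul (by positivity) (by positivity),
    log_mul (by positivity) (by positivity), log_mul (by positivity) (by positivity),
    log_mul (by positivity) (by positivity), log_mul (by positivity) (by positivity),
    log_mul (by positivity) (by positivity), log_mul (by positivity) (by positivity),
    log_mul (by positivity) (by positivity), log_mul (by positivity) (by positivity),
    log_pow, log_pow] at hPl
  push_cast at hDl hRl hkl hPl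
  have h1 : 1 / (y * log y) * (log n + log 5 - (A₂ * log 2 + A₃ * log 3 + log M0)) ≤
      log R - log 1000 := by
    rw [one_div_mul_eq_div, div_le_iff₀ (by positivity)]
    have h4 : (m : ℝ) * log y ≤ (10 * y * (log R - log 1000)) * log y := by
      gcongr
      linarith
    linarith
  have h5 : log k - log 100 ≤ log (log (log n)) := by
    rw [← log_div (by positivity) (by norm_num)]
    refine log_le_log (by positivity) (le_trans ?_ (log_le_log (by positivity) ha))
    rw [log_div (by positivity) (by norm_num)]
    linarith
  have h6 := log_sub_log_le_eulerMascheroniConstant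
  have h7 : log (5 / 4 : ℝ) = log 5 - log 4 := log_div (by norm_num) (by norm_num)
  linarith

lemma robinInequality_of_log_lt_nine_thousand {n q : ℕ} (hn : 5040 < n) (h9 : log n < 9000)
    (hq : q.Prime) (hq5 : q ≤ 5) (hqn : ¬ q ∣ n) : RobinInequality n := by
  have h85 : (85 / 10 : ℝ) ≤ log n := by
    have h1 : ((85 : ℕ) / (10 : ℕ) : ℝ) ≤ log (5041 : ℕ) :=
      le_log_of_pow_le (by norm_num) (by norm_num) (by decide +kernel)
    have h2 : log (5041 : ℕ) ≤ log n := log_le_log (by norm_num) (by exact_mod_cast hn)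
    push_cast at h1 h2
    linarith
  rcases le_total (log n) (108 / 10) with h | h108
  · exact robinInequality_of_mem_Icc (a := 85) (b := 108) hq hq5 hqn (by norm_num; linarith)
      (by norm_num; linarith) 12 4 2 6 1054 214 (by decide +kernel)
  rcases le_total (log n) (150 / 10) with h | h150
  · exact robinInequality_of_mem_Icc (a := 108) (b := 150) hq hq5 hqn (by norm_num; linarith)
      (by norm_num; linarith) 16 5 3 5 1034 237 (by decide +kernel)
  rcases le_total (log n) (229 / 10) with h | h229
  · exact robinInequality_of_mem_Icc (a := 150) (b := 229) hq hq5 hqn (by norm_num; linarith)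
      (by norm_num; linarith) 26 5 3 1 1005 270 (by decide +kernel)
  rcases le_total (log n) (407 / 10) with h | h407
  · exact robinInequality_of_mem_Icc (a := 229) (b := 407) hq hq5 hqn (by norm_num; linarith)
      (by norm_num; linarith) 42 6 4 6 1016 313 (by decide +kernel)
  rcases le_total (log n) (856 / 10) with h | h856
  · exact robinInequality_of_mem_Icc (a := 407) (b := 856) hq hq5 hqn (by norm_num; linarith)
      (by norm_num; linarith) 88 8 4 10 1012 370 (by decide +kernel)
  rcases le_total (log n) (2239 / 10) with h | h2239
  · exact robinInequality_of_mem_Icc (a := 856) (b := 2239) hq hq5 hqn (by norm_num; linarith)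
      (by norm_num; linarith) 228 9 6 18 1008 444 (by decide +kernel)
  rcases le_total (log n) (3970 / 10) with h | h3970
  · exact robinInequality_of_mem_Icc (a := 2239) (b := 3970) hq hq5 hqn (by norm_num; linarith)
      (by norm_num; linarith) 178 9 5 447 1286 541 (by decide +kernel)
  rcases le_total (log n) (7417 / 10) with h | h7417
  · exact robinInequality_of_mem_Icc (a := 3970) (b := 7417) hq hq5 hqn (by norm_num; linarith)
      (by norm_num; linarith) 311 10 6 772 1282 598 (by decide +kernel)
  rcases le_total (log n) (14756 / 10) with h | h14756
  · exact robinInequality_of_mem_Icc (a := 7417) (b := 14756) hq hq5 hqn (by norm_num; linarith)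
      (by norm_num; linarith) 582 11 7 1445 1282 660 (by decide +kernel)
  rcases le_total (log n) (31408 / 10) with h | h31408
  · exact robinInequality_of_mem_Icc (a := 14756) (b := 31408) hq hq5 hqn (by norm_num; linarith)
      (by norm_num; linarith) 1162 12 7 2850 1278 729 (by decide +kernel)
  rcases le_total (log n) (72039 / 10) with h | h72039
  · exact robinInequality_of_mem_Icc (a := 31408) (b := 72039) hq hq5 hqn (by norm_num; linarith)
      (by norm_num; linarith) 2502 13 8 6078 1275 805 (by decide +kernel)
  exact robinInequality_of_mem_Icc (a := 72039) (b := 90000) hq hq5 hqn (by norm_num; linarith)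
    (by norm_num; linarith) 2480 13 8 8450 1406 888 (by decide +kernel)

/-- Robin's inequality holds for every natural number `n > 5040` that is not
divisible by at least one of the primes `2`, `3`, `5`. -/
theorem robin_of_not_dvd_two_or_three_or_five (n : ℕ) (hn : 5040 < n)
    (h : ¬ (2 ∣ n) ∨ ¬ (3 ∣ n) ∨ ¬ (5 ∣ n)) : RobinInequality n := by
  obtain ⟨q, hq, hq5, hqn⟩ : ∃ q : ℕ, q.Prime ∧ q ≤ 5 ∧ ¬ q ∣ n := by
    rcases h with h | h | h
    · exact ⟨2, Nat.prime_two, by norm_num, h⟩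
    · exact ⟨3, Nat.prime_three, by norm_num, h⟩
    · exact ⟨5, Nat.prime_five, le_rfl, h⟩
  rcases le_or_gt 9000 (log n) with h9 | h9
  · exact robinInequality_of_le_log h9 hq hq5 hqn
  · exact robinInequality_of_log_lt_nine_thousand hn h9 hq hq5 hqn
end

section
/- For every odd natural number n ≥ 620, Robin's inequality holds for 2n: σ(2n) < e^γ · 2n · log(log(2n)). -/
open Real

open Finset ArithmeticFunction in
/-- `σ(n) ≤ n · ∏_{p ∣ n} p / (p - 1)`. -/
theorem sigma_one_le_mul_prod_primeFactors {n : ℕ} (hn : n ≠ 0) :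
    (sigma 1 n : ℝ) ≤ n * ∏ p ∈ n.primeFactors, (p : ℝ) / (p - 1) := by
  have hfac : (n : ℝ) = ∏ p ∈ n.primeFactors, (p : ℝ) ^ n.factorization p := by
    conv_lhs => rw [← Nat.prod_factorization_pow_eq_self hn]
    rw [Finsupp.prod, Nat.support_factorization]
    push_cast
    rfl
  rw [sigma_eq_prod_primeFactors_sum_range_factorization_pow_mul hn]
  conv_rhs => rw [hfac]
  rw [← prod_mul_distrib]
  push_cast
  refine prod_le_prod (fun p _ ↦ by positivity) fun p hp ↦ ?_
  have hp1 : (1 : ℝ) < p := mod_cast (Nat.prime_of_mem_primeFactors hp).one_lt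
  simp only [mul_one]
  rw [geom_sum_eq hp1.ne', ← mul_div_assoc, ← pow_succ]
  have : (0 : ℝ) ≤ p - 1 := by linarith
  gcongr
  linarith

theorem one_lt_div_sub_one_self {x : ℝ} (hx : 1 < x) : 1 < x / (x - 1) := by
  rw [lt_div_iff₀ (by linarith)]
  linarith

theorem div_sub_one_self_antitone {x y : ℝ} (hx : 1 < x) (hxy : x ≤ y) :
    y / (y - 1) ≤ x / (x - 1) := by
  rw [div_le_div_iff₀ (by linarith) (by linarith)]
  linarith

open Finset in
/-- Among finite sets of primes of bounded size, an initial segment of the primes maximises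
`∏ p / (p - 1)`. -/
theorem prod_div_sub_one_le_of_card_le {S : Finset ℕ} (hS : ∀ p ∈ S, p.Prime) {x : ℕ}
    (hx : 2 ≤ x) (hcard : #S ≤ #(Nat.primesLE x)) :
    ∏ p ∈ S, (p : ℝ) / (p - 1) ≤ ∏ p ∈ Nat.primesLE x, (p : ℝ) / (p - 1) := by
  set T := Nat.primesLE x
  have hx1 : (1 : ℝ) < x := mod_cast hx
  have hc : #(S \ T) ≤ #(T \ S) := by
    have h₁ := card_sdiff_add_card_inter S T
    have h₂ := card_sdiff_add_card_inter T S
    rw [inter_comm T S] at h₂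
    omega
  have hST : ∏ p ∈ S \ T, (p : ℝ) / (p - 1) ≤ ((x : ℝ) / (x - 1)) ^ #(S \ T) := by
    rw [← prod_const]
    refine prod_le_prod (fun p hp ↦ ?_) fun p hp ↦ ?_
    all_goals
      rw [mem_sdiff, Nat.mem_primesLE] at hp
      have hxp : x ≤ p := by
        by_contra! h
        exact hp.2 ⟨h.le, hS p hp.1⟩
      have hxp' : (x : ℝ) ≤ p := mod_cast hxp
    · exact (zero_le_one.trans (one_lt_div_sub_one_self (hx1.trans_le hxp')).le)
    · exact div_sub_one_self_antitone hx1 hxp'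
  have hTS : ((x : ℝ) / (x - 1)) ^ #(T \ S) ≤ ∏ p ∈ T \ S, (p : ℝ) / (p - 1) := by
    rw [← prod_const]
    refine prod_le_prod (fun p _ ↦ (zero_le_one.trans (one_lt_div_sub_one_self hx1).le))
      fun p hp ↦ ?_
    rw [mem_sdiff, Nat.mem_primesLE] at hp
    exact div_sub_one_self_antitone (mod_cast hp.1.2.one_lt) (mod_cast hp.1.1)
  have hpow : ((x : ℝ) / (x - 1)) ^ #(S \ T) ≤ ((x : ℝ) / (x - 1)) ^ #(T \ S) :=
    pow_le_pow_right₀ (one_lt_div_sub_one_self hx1).le hc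
  rw [← prod_inter_mul_prod_sdiff S T, ← prod_inter_mul_prod_sdiff T S, inter_comm T S]
  refine mul_le_mul_of_nonneg_left (hST.trans (hpow.trans hTS)) (prod_nonneg fun p hp ↦ ?_)
  have : (1 : ℝ) < p := mod_cast (hS p (mem_inter.mp hp).1).one_lt
  exact zero_le_one.trans (one_lt_div_sub_one_self this).le

open Finset in
/-- Among finite sets of primes of bounded size, an initial segment of the primes minimises
the product. -/
theorem primorial_le_prod_of_card_le {S : Finset ℕ} (hS : ∀ p ∈ S, p.Prime) {x : ℕ}
    (hx : 1 ≤ x) (hcard : #(Nat.primesLE x) ≤ #S) :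
    primorial x ≤ ∏ p ∈ S, p := by
  rw [primorial_eq_prod_primesLE]
  set T := Nat.primesLE x
  have hc : #(T \ S) ≤ #(S \ T) := by
    have h₁ := card_sdiff_add_card_inter S T
    have h₂ := card_sdiff_add_card_inter T S
    rw [inter_comm T S] at h₂
    omega
  have hST : x ^ #(S \ T) ≤ ∏ p ∈ S \ T, p := by
    refine pow_card_le_prod _ _ _ fun p hp ↦ ?_
    rw [mem_sdiff, Nat.mem_primesLE] at hp
    by_contra! h
    exact hp.2 ⟨h.le, hS p hp.1⟩
  have hTS : ∏ p ∈ T \ S, p ≤ x ^ #(T \ S) :=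
    prod_le_pow_card _ _ _ fun p hp ↦ (Nat.mem_primesLE.mp (mem_sdiff.mp hp).1).1
  rw [← prod_inter_mul_prod_sdiff S T, ← prod_inter_mul_prod_sdiff T S, inter_comm T S]
  exact Nat.mul_le_mul_left _ (hTS.trans ((Nat.pow_le_pow_right hx hc).trans hST))

open ArithmeticFunction in
/-- For odd `n`, the prime `2` contributes only `3 / 2` instead of `2 / (2 - 1)` to
`σ(2n) / (2n)`. -/
theorem sigma_one_two_mul_odd_le {n : ℕ} (hn : Odd n) :
    (sigma 1 (2 * n) : ℝ) ≤
      2 * n * (3 / 4 * ∏ p ∈ (2 * n).primeFactors, (p : ℝ) / (p - 1)) := by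
  have hn0 : n ≠ 0 := by rintro rfl; simp at hn
  have hcop : Nat.Coprime 2 n := hn.coprime_two_left
  have h2 : sigma 1 2 = 3 := by decide
  rw [isMultiplicative_sigma.map_mul_of_coprime hcop, h2, hcop.primeFactors_mul,
    Finset.prod_union hcop.disjoint_primeFactors, Nat.prime_two.primeFactors,
    Finset.prod_singleton]
  push_cast
  linarith [sigma_one_le_mul_prod_primeFactors hn0]

open Finset Chebyshev in
/-- The inequality for all `2n` with `n` odd follows from the corresponding one for primorials. -/
theorem robinInequality_two_mul_of_primorial
    (hsmall : 3 / 4 * ∏ p ∈ Nat.primesLE 7, (p : ℝ) / (p - 1) <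
      exp eulerMascheroniConstant * log (log 1240))
    (hlarge : ∀ x : ℕ, 11 ≤ x → 3 / 4 * ∏ p ∈ Nat.primesLE x, (p : ℝ) / (p - 1) <
      exp eulerMascheroniConstant * log (θ x))
    {n : ℕ} (hn : Odd n) (h : 620 ≤ n) :
    (ArithmeticFunction.sigma 1 (2 * n) : ℝ) <
      exp eulerMascheroniConstant * (2 * n : ℕ) * log (log (2 * n : ℕ)) := by
  have hn0 : 2 * n ≠ 0 := by omega
  have hS : ∀ p ∈ (2 * n).primeFactors, p.Prime := fun p hp ↦ Nat.prime_of_mem_primeFactors hp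
  suffices H : 3 / 4 * ∏ p ∈ (2 * n).primeFactors, (p : ℝ) / (p - 1) <
      exp eulerMascheroniConstant * log (log (2 * n : ℕ)) by
    refine (sigma_one_two_mul_odd_le hn).trans_lt ?_
    have hpos : (0 : ℝ) < 2 * n := by positivity
    push_cast at H ⊢
    nlinarith [mul_lt_mul_of_pos_left H hpos]
  rcases le_or_gt #(2 * n).primeFactors 4 with hk | hk
  · have hcard : #(Nat.primesLE 7) = 4 := by decide
    have h1240 : (1240 : ℝ) ≤ (2 * n : ℕ) := by exact_mod_cast (by omega : 1240 ≤ 2 * n)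
    have hP := prod_div_sub_one_le_of_card_le hS (by norm_num : 2 ≤ 7) (hk.trans hcard.ge)
    have hlog : log (log 1240) ≤ log (log (2 * n : ℕ)) :=
      log_le_log (log_pos (by norm_num)) (log_le_log (by norm_num) h1240)
    calc _ ≤ 3 / 4 * ∏ p ∈ Nat.primesLE 7, (p : ℝ) / (p - 1) := by gcongr
      _ < _ := hsmall
      _ ≤ _ := by gcongr
  · obtain ⟨k, hk'⟩ : ∃ k, #(2 * n).primeFactors = k + 1 := ⟨_, (Nat.succ_pred (by omega)).symm⟩
    set x := Nat.nth Nat.Prime k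
    have hcard : #(Nat.primesLE x) = k + 1 := by
      rw [Nat.primesLE_card_eq_primeCounting, Nat.primeCounting, Nat.primeCounting',
        Nat.count_succ, if_pos (Nat.prime_nth_prime k)]
      exact congrArg (· + 1) (Nat.primeCounting'_nth_eq k)
    have hx : 11 ≤ x := by
      by_contra! hx
      have : #(Nat.primesLE x) ≤ #(Nat.primesLE 10) := card_le_card (Nat.primesLE_mono (by omega))
      have h10 : #(Nat.primesLE 10) = 4 := by decide
      omega
    have hP := prod_div_sub_one_le_of_card_le hS (by omega : 2 ≤ x) (by omega)
    have hθ : θ x ≤ log (2 * n : ℕ) := by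
      rw [theta_eq_log_primorial, Nat.floor_natCast]
      refine log_le_log (mod_cast primorial_pos x) ?_
      exact_mod_cast (primorial_le_prod_of_card_le hS (by omega) (by omega)).trans
        (Nat.le_of_dvd (by omega) (Nat.prod_primeFactors_dvd _))
    have hθ0 : 0 < θ x := theta_pos (by exact_mod_cast (by omega : 2 ≤ x))
    calc _ ≤ 3 / 4 * ∏ p ∈ Nat.primesLE x, (p : ℝ) / (p - 1) := by gcongr
      _ < _ := hlarge x hx
      _ ≤ _ := by gcongr

theorem log_factorial_le_s2 {n : ℕ} (hn : n ≠ 0) :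
    log (n.factorial) ≤ n * log n - n + log n + 1 := by
  induction n, Nat.one_le_iff_ne_zero.mpr hn using Nat.le_induction with
  | base => simp
  | succ n hn₁ ih =>
    have hn0 : (0 : ℝ) < n := Nat.cast_pos.mpr hn₁
    have hlog := one_sub_inv_le_log_of_pos (show (0 : ℝ) < (n + 1) / n by positivity)
    rw [log_div (by positivity) (by positivity), inv_div] at hlog
    have hlog' : 1 ≤ (n + 1) * (log (n + 1) - log n) := by
      calc (1 : ℝ) = (n + 1) * (1 - n / (n + 1)) := by field_simp; ring
        _ ≤ _ := by gcongr
    rw [Nat.factorial_succ, Nat.cast_mul, log_mul (by positivity) (by positivity)]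
    push_cast
    linarith [ih (by omega)]

theorem mul_log_sub_self_le_log_factorial (n : ℕ) : n * log n - n ≤ log (n.factorial) := by
  rcases eq_or_ne n 0 with rfl | hn
  · simp
  · have h₁ := Stirling.le_log_factorial_stirling hn
    have h₂ : 0 ≤ log n := log_natCast_nonneg n
    have h₃ : 0 ≤ log (2 * π) := log_nonneg (by linarith [pi_gt_three])
    linarith

open Finset in
theorem sum_vonMangoldt_mul_div_eq_log_factorial (n : ℕ) :
    ∑ d ∈ Ioc 0 n, ArithmeticFunction.vonMangoldt d * (n / d : ℕ) = log (n.factorial) := by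
  rw [← ArithmeticFunction.sum_Ioc_mul_zeta_eq_sum, ArithmeticFunction.vonMangoldt_mul_zeta,
    ← prod_Ico_id_eq_factorial, Nat.cast_prod,
    log_prod fun i hi ↦ Nat.cast_ne_zero.mpr (by have := mem_Ico.mp hi; omega)]
  exact sum_congr (by ext; simp; omega) fun _ _ ↦ rfl

open Finset in
/-- Lower half of Mertens' first theorem. -/
theorem log_sub_one_le_sum_vonMangoldt_div {n : ℕ} (hn : n ≠ 0) :
    log n - 1 ≤ ∑ d ∈ Ioc 0 n, ArithmeticFunction.vonMangoldt d / d := by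
  have hn0 : (0 : ℝ) < n := by positivity
  refine le_of_mul_le_mul_left ?_ hn0
  calc n * (log n - 1) = n * log n - n := by ring
    _ ≤ log (n.factorial) := mul_log_sub_self_le_log_factorial n
    _ = ∑ d ∈ Ioc 0 n, ArithmeticFunction.vonMangoldt d * (n / d : ℕ) :=
      (sum_vonMangoldt_mul_div_eq_log_factorial n).symm
    _ ≤ ∑ d ∈ Ioc 0 n, ArithmeticFunction.vonMangoldt d * (n / d) := by
      refine sum_le_sum fun d _ ↦ ?_
      exact mul_le_mul_of_nonneg_left Nat.cast_div_le ArithmeticFunction.vonMangoldt_nonneg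
    _ = _ := by
      rw [mul_sum]
      exact sum_congr rfl fun _ _ ↦ by ring

open Finset Chebyshev in
/-- Upper half of Mertens' first theorem. -/
theorem mul_sum_vonMangoldt_div_le {n : ℕ} (hn : n ≠ 0) :
    n * ∑ d ∈ Ioc 0 n, ArithmeticFunction.vonMangoldt d / d ≤ n * log n - n + log n + 1 + ψ n := by
  have hfloor : ∀ d ∈ Ioc 0 n, (n : ℝ) / d ≤ (n / d : ℕ) + 1 := fun d hd ↦ by
    rw [← Nat.floor_div_eq_div (K := ℝ)]
    exact (Nat.lt_floor_add_one _).le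
  calc n * ∑ d ∈ Ioc 0 n, ArithmeticFunction.vonMangoldt d / d
      = ∑ d ∈ Ioc 0 n, ArithmeticFunction.vonMangoldt d * (n / d) := by
        rw [mul_sum]
        exact sum_congr rfl fun _ _ ↦ by ring
    _ ≤ ∑ d ∈ Ioc 0 n, ArithmeticFunction.vonMangoldt d * ((n / d : ℕ) + 1) :=
      sum_le_sum fun d hd ↦ mul_le_mul_of_nonneg_left (hfloor d hd)
        ArithmeticFunction.vonMangoldt_nonneg
    _ = log (n.factorial) + ψ n := by
      simp only [mul_add, mul_one, sum_add_distrib, sum_vonMangoldt_mul_div_eq_log_factorial,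
        psi, Nat.floor_natCast]
    _ ≤ _ := by linarith [log_factorial_le_s2 hn]

open Finset in
/-- Partial summation: a bound on `∑ a n` of the shape `log n + C` gives a bound on
`∑ a n / log n` of the shape `log (log n) + C'`. -/
theorem sum_div_log_le {y : ℕ} (hy : 2 ≤ y) {a : ℕ → ℝ} {c : ℝ}
    (hS : ∀ n, y ≤ n → ∑ k ∈ Ioc y n, a k ≤ log n - log y + c) {n : ℕ} (hn : y ≤ n) :
    ∑ k ∈ Ioc y n, a k / log k ≤ log (log n) - log (log y) + c / log y := by
  suffices H : ∑ k ∈ Ioc y n, a k / log k ≤ log (log n) - log (log y) + c / log y -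
      (log n - log y + c - ∑ k ∈ Ioc y n, a k) / log n by
    have : 0 ≤ (log n - log y + c - ∑ k ∈ Ioc y n, a k) / log n :=
      div_nonneg (by linarith [hS n hn]) (log_natCast_nonneg n)
    linarith
  induction n, hn using Nat.le_induction with
  | base => simp
  | succ n hn ih =>
    rw [sum_Ioc_succ_top (by omega), sum_Ioc_succ_top (by omega)]
    set S := ∑ k ∈ Ioc y n, a k
    have hl : 0 < log (n : ℝ) := log_pos (mod_cast (by omega : 1 < n))
    have hll : log (n : ℝ) ≤ log (n + 1 : ℕ) :=
      log_le_log (mod_cast (by omega : 0 < n)) (mod_cast (by omega))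
    have hl' := hl.trans_le hll
    have hanti : (log n - log y + c - S) / log (n + 1 : ℕ) ≤ (log n - log y + c - S) / log n := by
      have := hS n hn
      gcongr
    have hlog := one_sub_inv_le_log_of_pos (div_pos hl' hl)
    rw [log_div hl'.ne' hl.ne', inv_div] at hlog
    have e : (log (n + 1 : ℕ) - log y + c - (S + a (n + 1))) / log (n + 1 : ℕ) =
        (log n - log y + c - S) / log (n + 1 : ℕ) + (1 - log n / log (n + 1 : ℕ)) -
          a (n + 1) / log (n + 1 : ℕ) := by
      field_simp
      ring
    rw [e]
    linarith

theorem log_le_tenth_mul_sqrt {x : ℝ} (hx : 8192 ≤ x) : log x ≤ √x / 10 := by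
  have he : exp 2 ≤ 8192 := by
    have := exp_one_lt_d9
    have h2 : exp 2 = exp 1 ^ 2 := by rw [← exp_nat_mul]; norm_num
    rw [h2]
    nlinarith [exp_pos 1]
  have h := log_div_sqrt_antitoneOn (Set.mem_Ici.mpr he) (Set.mem_Ici.mpr (he.trans hx)) hx
  have hs : (90.5 : ℝ) ≤ √8192 := le_sqrt_of_sq_le (by norm_num)
  have hl : log (8192 : ℝ) ≤ 9.05 := by
    rw [show (8192 : ℝ) = 2 ^ 13 by norm_num, log_pow]
    push_cast
    linarith [log_two_lt_d9]
  have hd : log (8192 : ℝ) / √8192 ≤ 1 / 10 := by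
    rw [div_le_div_iff₀ (by linarith) (by norm_num)]
    linarith
  have hpos : 0 < √x := sqrt_pos.mpr (by linarith)
  have := h.trans hd
  rw [div_le_div_iff₀ hpos (by norm_num)] at this
  linarith

theorem ninety_le_sqrt {x : ℝ} (hx : 8192 ≤ x) : 90 ≤ √x :=
  le_sqrt_of_sq_le (by linarith)

open Chebyshev in
theorem theta_ge_mul_self {n : ℕ} (hn : 8192 ≤ n) : 0.49 * n ≤ θ n := by
  have hx : (8192 : ℝ) ≤ n := mod_cast hn
  have h₁ := log_le_tenth_mul_sqrt hx
  have h₂ := ninety_le_sqrt hx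
  have h₃ : √(n : ℝ) * √n = n := mul_self_sqrt (by linarith)
  have h₄ : log (n + 1) ≤ log n + 1 / n := by
    have := log_le_sub_one_of_pos (show (0 : ℝ) < (n + 1) / n by positivity)
    rw [log_div (by positivity) (by positivity), add_div, div_self (by positivity)] at this
    linarith
  have h₅ : 1 / (n : ℝ) ≤ 1 := by
    rw [div_le_one (by linarith)]
    linarith
  have h₆ := log_two_gt_d9
  have h₇ : 2 * √(n : ℝ) * log n ≤ 0.2 * n := by nlinarith
  have h₈ : √(n : ℝ) ≤ n / 90 := by nlinarith
  have h₉ : 0.69314 * (n : ℝ) ≤ n * log 2 := by nlinarith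
  linarith [theta_ge n]

open Finset Chebyshev in
theorem sum_vonMangoldt_div_le {n : ℕ} (hn : 8192 ≤ n) :
    ∑ d ∈ Ioc 0 n, ArithmeticFunction.vonMangoldt d / d ≤ log n + 0.59 := by
  have hx : (8192 : ℝ) ≤ n := mod_cast hn
  have h₁ := log_le_tenth_mul_sqrt hx
  have h₂ := ninety_le_sqrt hx
  have h₃ : √(n : ℝ) * √n = n := mul_self_sqrt (by linarith)
  have h₄ : 2 * √(n : ℝ) * log n ≤ 0.2 * n := by nlinarith
  have h₅ : √(n : ℝ) ≤ n / 90 := by nlinarith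
  have h₆ : log 4 ≤ 1.3863 := by
    rw [show (4 : ℝ) = 2 ^ 2 by norm_num, log_pow]
    push_cast
    linarith [log_two_lt_d9]
  have h₇ : log 4 * n ≤ 1.3863 * n := by gcongr
  have h₈ := psi_le (x := n) (by linarith)
  have h₉ := mul_sum_vonMangoldt_div_le (n := n) (by omega)
  refine le_of_mul_le_mul_left (h₉.trans ?_) (show (0 : ℝ) < n by linarith)
  linarith

open Finset in
/-- An upper bound in Mertens' second theorem, for the primes beyond `8192`. -/
theorem sum_one_div_primes_le {n : ℕ} (hn : 8192 ≤ n) :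
    ∑ k ∈ Ioc 8192 n, (if k.Prime then 1 / (k : ℝ) else 0) ≤
      log (log n) - log (log 8192) + 1.59 / log 8192 := by
  have key := sum_div_log_le (y := 8192) (by norm_num)
    (a := fun k ↦ if k.Prime then log k / k else 0) (c := 1.59) (fun m hm ↦ ?_) hn
  · refine le_trans (le_of_eq (sum_congr rfl fun k hk ↦ ?_)) (by exact_mod_cast key)
    split_ifs with hp
    · have : log (k : ℝ) ≠ 0 := (log_pos (mod_cast hp.one_lt)).ne'
      field_simp
    · simp
  · have h₁ : ∑ k ∈ Ioc 8192 m, (if k.Prime then log (k : ℝ) / k else 0) ≤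
        ∑ k ∈ Ioc 8192 m, ArithmeticFunction.vonMangoldt k / k := by
      refine sum_le_sum fun k _ ↦ ?_
      split_ifs with hp
      · rw [ArithmeticFunction.vonMangoldt_apply_prime hp]
      · exact div_nonneg ArithmeticFunction.vonMangoldt_nonneg (Nat.cast_nonneg k)
    have h₂ := sum_Ioc_consecutive (fun k ↦ ArithmeticFunction.vonMangoldt k / (k : ℝ))
      (Nat.zero_le 8192) hm
    have h₃ := log_sub_one_le_sum_vonMangoldt_div (n := 8192) (by norm_num)
    linarith [sum_vonMangoldt_div_le hm]

open Finset in
theorem prod_primesLE_div_sub_one_le_mul_exp {y n : ℕ} (hy : y ≠ 0) (hn : y ≤ n) :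
    ∏ p ∈ Nat.primesLE n, (p : ℝ) / (p - 1) ≤ (∏ p ∈ Nat.primesLE y, (p : ℝ) / (p - 1)) *
      exp (∑ k ∈ Ioc y n, (if k.Prime then 1 / (k : ℝ) else 0) + (1 / y - 1 / n)) := by
  induction n, hn using Nat.le_induction with
  | base => simp
  | succ n hn ih =>
    have hn0 : (0 : ℝ) < n := Nat.cast_pos.mpr (by omega)
    have hP : 0 ≤ ∏ p ∈ Nat.primesLE y, (p : ℝ) / (p - 1) := prod_nonneg fun p hp ↦ by
      have : (1 : ℝ) ≤ p := mod_cast (Nat.prime_of_mem_primesLE hp).one_le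
      exact div_nonneg (by linarith) (by linarith)
    rw [sum_Ioc_succ_top (by omega), Nat.primesLE_succ]
    set S := ∑ k ∈ Ioc y n, (if k.Prime then 1 / (k : ℝ) else 0)
    split_ifs with hp
    · rw [prod_insert (Nat.notMem_primesLE n)]
      have h₁ : ((n + 1 : ℕ) : ℝ) / ((n + 1 : ℕ) - 1) ≤ exp (1 / n) := by
        have := add_one_le_exp (1 / (n : ℝ))
        push_cast
        rw [add_sub_cancel_right, add_div, div_self hn0.ne']
        linarith
      calc _ ≤ exp (1 / n) * ((∏ p ∈ Nat.primesLE y, (p : ℝ) / (p - 1)) *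
              exp (S + (1 / y - 1 / n))) := by
            refine mul_le_mul h₁ ih (prod_nonneg fun p hp ↦ ?_) (exp_pos _).le
            have : (1 : ℝ) ≤ p := mod_cast (Nat.prime_of_mem_primesLE hp).one_le
            exact div_nonneg (by linarith) (by linarith)
        _ = _ := by
            rw [mul_left_comm, ← exp_add]
            congr 2
            ring
    · refine ih.trans (mul_le_mul_of_nonneg_left (exp_le_exp.mpr ?_) hP)
      have : 1 / ((n + 1 : ℕ) : ℝ) ≤ 1 / n := one_div_le_one_div_of_le hn0 (by push_cast; linarith)
      linarith

open Chebyshev in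
theorem prod_primesLE_lt_log_theta_of_large {G : ℝ} (hG : 1.775 ≤ G)
    (h : 3 / 4 * ∏ p ∈ Nat.primesLE 8192, (p : ℝ) / (p - 1) ≤ 12.05) {n : ℕ} (hn : 8192 ≤ n) :
    3 / 4 * ∏ p ∈ Nat.primesLE n, (p : ℝ) / (p - 1) < G * log (θ n) := by
  have hx : (8192 : ℝ) ≤ n := mod_cast hn
  have hy : 9.01 ≤ log (8192 : ℝ) := by
    rw [show (8192 : ℝ) = 2 ^ 13 by norm_num, log_pow]
    push_cast
    linarith [log_two_gt_d9]
  have hL : log (8192 : ℝ) ≤ log n := log_le_log (by norm_num) hx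
  have hθ : log n - 0.72 ≤ log (θ n) := by
    have h₁ : exp (-0.72) ≤ 0.49 := by
      rw [exp_neg]
      refine inv_le_of_inv_le₀ (by norm_num) ?_
      refine le_of_pow_le_pow_left₀ (n := 25) (by norm_num) (exp_pos _).le ?_
      rw [← exp_nat_mul, show ((25 : ℕ) : ℝ) * 0.72 = (18 : ℕ) * 1 by norm_num, exp_nat_mul]
      refine le_trans ?_ (pow_le_pow_left₀ (by norm_num) exp_one_gt_d9.le 18)
      norm_num
    have h₂ : exp (log n - 0.72) ≤ θ n := by
      rw [sub_eq_add_neg, exp_add, exp_log (by linarith), mul_comm]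
      exact (mul_le_mul_of_nonneg_right h₁ (by linarith)).trans (theta_ge_mul_self hn)
    exact (le_log_iff_exp_le ((exp_pos _).trans_le h₂)).mpr h₂
  have hexp : exp (∑ k ∈ Finset.Ioc 8192 n, (if k.Prime then 1 / (k : ℝ) else 0) +
      (1 / (8192 : ℕ) - 1 / n)) ≤ log n / 9.01 * 1.2 := by
    have h₁ := sum_one_div_primes_le hn
    have h₂ : 1.59 / log (8192 : ℝ) ≤ 0.177 := by
      rw [div_le_iff₀ (by linarith)]
      linarith
    have h₃ : (0 : ℝ) ≤ 1 / n := by positivity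
    have h₄ : exp 0.18 ≤ 1.2 := by
      refine le_of_pow_le_pow_left₀ (n := 50) (by norm_num) (by norm_num) ?_
      rw [← exp_nat_mul, show ((50 : ℕ) : ℝ) * 0.18 = (9 : ℕ) * 1 by norm_num, exp_nat_mul]
      refine (pow_le_pow_left₀ (exp_pos _).le exp_one_lt_d9.le 9).trans ?_
      norm_num
    calc _ ≤ exp (log (log n) - log (log 8192) + 0.18) := by
          refine exp_le_exp.mpr ?_
          push_cast
          linarith
      _ = log n / log 8192 * exp 0.18 := by
          rw [exp_add, exp_sub, exp_log (by linarith), exp_log (by linarith)]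
      _ ≤ _ := by gcongr
  have hP := prod_primesLE_div_sub_one_le_mul_exp (y := 8192) (by norm_num) hn
  have hl : 0 ≤ log (n : ℝ) := by linarith
  calc _ ≤ 3 / 4 * ((∏ p ∈ Nat.primesLE 8192, (p : ℝ) / (p - 1)) * _) := by gcongr
    _ = (3 / 4 * ∏ p ∈ Nat.primesLE 8192, (p : ℝ) / (p - 1)) * _ := by rw [mul_assoc]
    _ ≤ 12.05 * (log n / 9.01 * 1.2) := mul_le_mul h hexp (exp_pos _).le (by norm_num)
    _ < 1.775 * (log n - 0.72) := by
      have : 9.01 ≤ log (n : ℝ) := hy.trans hL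
      norm_num at this ⊢
      linarith
    _ ≤ _ := by gcongr; linarith

/-- A primality test valid below `97 ^ 2`. -/
def primeTest (n : ℕ) : Prop :=
  2 ≤ n ∧ Nat.gcd n (if n ≤ 96 then (n - 1).factorial else Nat.factorial 96) = 1

instance : DecidablePred primeTest := fun _ ↦ inferInstanceAs (Decidable (_ ∧ _))

theorem prime_iff_coprime_factorial {n m : ℕ} (hn : 2 ≤ n) (hm : m < n) (hnm : n < (m + 1) ^ 2) :
    n.Prime ↔ Nat.Coprime n m.factorial := by
  constructor
  · exact fun h ↦ (Nat.coprime_factorial_iff h.ne_one).mpr (by rwa [h.minFac_eq])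
  · intro h
    rw [Nat.coprime_factorial_iff (by omega)] at h
    by_contra hp
    have := Nat.minFac_sq_le_self (by omega) hp
    nlinarith

theorem primeTest_iff {n : ℕ} (hn : n < 97 ^ 2) : primeTest n ↔ n.Prime := by
  unfold primeTest
  rcases lt_or_ge n 2 with h2 | h2
  · exact ⟨fun h ↦ by omega, fun h ↦ absurd h.two_le (by omega)⟩
  · simp only [h2, true_and]
    split_ifs with h
    · refine (prime_iff_coprime_factorial h2 (by omega) ?_).symm
      rw [Nat.sub_add_cancel (by omega)]
      nlinarith
    · exact (prime_iff_coprime_factorial h2 (by omega) hn).symm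

/-- The product of `f p` over the primes `lo ≤ p < lo + 2 ^ k`, computed by bisection. -/
def primeProd (f : ℕ → ℕ) : ℕ → ℕ → ℕ
  | 0, lo => if primeTest lo then f lo else 1
  | k + 1, lo => primeProd f k lo * primeProd f k (lo + 2 ^ k)

theorem primeProd_eq (f : ℕ → ℕ) {k lo : ℕ} (h : lo + 2 ^ k ≤ 97 ^ 2) :
    primeProd f k lo = ∏ p ∈ Finset.Ico lo (lo + 2 ^ k) with p.Prime, f p := by
  induction k generalizing lo with
  | zero => simp [primeProd, primeTest_iff (n := lo) (by simpa using h), Finset.prod_filter]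
  | succ k ih =>
    rw [pow_succ] at h ⊢
    rw [primeProd, ih (by omega), ih (by omega), Finset.prod_filter, Finset.prod_filter,
      Finset.prod_filter, Finset.prod_Ico_consecutive _ (by omega) (by omega)]
    congr 2
    omega

theorem prod_primesLE_eq_primeProd (f : ℕ → ℕ) {k x : ℕ} (hx : x < 2 ^ k) (hk : k ≤ 13) :
    ∏ p ∈ Nat.primesLE x, f p = primeProd (fun p ↦ if p ≤ x then f p else 1) k 0 := by
  have : 2 ^ k ≤ 2 ^ 13 := Nat.pow_le_pow_right (by norm_num) hk
  rw [primeProd_eq _ (by omega), ← Finset.prod_filter, Finset.filter_filter]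
  refine Finset.prod_congr ?_ fun _ _ ↦ rfl
  ext p
  simp only [Nat.mem_primesLE, Finset.mem_filter, Finset.mem_Ico]
  grind

theorem prod_primesLE_div_sub_one_eq (x : ℕ) :
    ∏ p ∈ Nat.primesLE x, (p : ℝ) / (p - 1) =
      (∏ p ∈ Nat.primesLE x, p : ℕ) / (∏ p ∈ Nat.primesLE x, (p - 1) : ℕ) := by
  rw [Finset.prod_div_distrib]
  push_cast
  congr 1
  refine Finset.prod_congr rfl fun p hp ↦ ?_
  rw [Nat.cast_pred (Nat.prime_of_mem_primesLE hp).pos]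

theorem prod_primesLE_div_sub_one_mono {m n : ℕ} (h : m ≤ n) :
    ∏ p ∈ Nat.primesLE m, (p : ℝ) / (p - 1) ≤ ∏ p ∈ Nat.primesLE n, (p : ℝ) / (p - 1) := by
  have hp1 : ∀ p ∈ Nat.primesLE n, (1 : ℝ) < p := fun p hp ↦
    mod_cast (Nat.prime_of_mem_primesLE hp).one_lt
  refine Finset.prod_le_prod_of_subset_of_one_le (Nat.primesLE_mono h) (fun p hp ↦ ?_)
    fun p hp _ ↦ ?_
  · have := hp1 p (Nat.primesLE_mono h hp)
    exact div_nonneg (by linarith) (by linarith)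
  · have := hp1 p hp
    rw [one_le_div (by linarith)]
    linarith

theorem div_le_log_of_pow_le {a b : ℕ} {t : ℝ} (hb : b ≠ 0) (ht : 0 < t)
    (h : (2.7183 : ℝ) ^ a ≤ t ^ b) : (a / b : ℝ) ≤ log t := by
  rw [le_log_iff_exp_le ht]
  refine le_of_pow_le_pow_left₀ hb ht.le (le_trans ?_ h)
  rw [← exp_nat_mul, mul_div_cancel₀ _ (by positivity), ← mul_one (a : ℝ), exp_nat_mul]
  exact pow_le_pow_left₀ (exp_pos _).le (by linarith [exp_one_lt_d9]) a

open Chebyshev in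
/-- A finite certificate for the bound on a whole interval: `u / v` is a lower bound for `θ x`
and `a / b` a lower bound for `log (u / v)`. -/
theorem prod_primesLE_lt_log_theta_of_certificate {G : ℝ} (hG : 71 / 40 ≤ G) (k u v a b x z : ℕ)
    {n : ℕ} (hxn : x ≤ n) (hnz : n ≤ z)
    (hk : k ≤ 13) (hxz : x ≤ z) (hz : z < 2 ^ k) (hu : u ≠ 0) (hv : v ≠ 0) (hb : b ≠ 0)
    (h₁ : 27183 ^ u ≤ 10000 ^ u * primeProd (fun p ↦ if p ≤ x then p else 1) k 0 ^ v)
    (h₂ : 27183 ^ a * v ^ b ≤ 10000 ^ a * u ^ b)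
    (h₃ : 120 * b * primeProd (fun p ↦ if p ≤ z then p else 1) k 0 <
      284 * a * primeProd (fun p ↦ if p ≤ z then p - 1 else 1) k 0) :
    3 / 4 * ∏ p ∈ Nat.primesLE n, (p : ℝ) / (p - 1) < G * log (θ n) := by
  rw [← prod_primesLE_eq_primeProd (fun p ↦ p) (hxz.trans_lt hz) hk,
    ← primorial_eq_prod_primesLE] at h₁
  rw [← prod_primesLE_eq_primeProd (fun p ↦ p) hz hk,
    ← prod_primesLE_eq_primeProd (fun p ↦ p - 1) hz hk] at h₃
  have hθ : (u / v : ℝ) ≤ θ n := by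
    refine le_trans ?_ (theta_mono (Nat.cast_le.mpr hxn))
    rw [theta_eq_log_primorial, Nat.floor_natCast]
    refine div_le_log_of_pow_le hv (mod_cast primorial_pos x) ?_
    have : (27183 : ℝ) ^ u ≤ 10000 ^ u * (primorial x : ℝ) ^ v := mod_cast h₁
    rw [show (2.7183 : ℝ) = 27183 / 10000 by norm_num, div_pow, div_le_iff₀ (by positivity)]
    linarith
  have hlog : (a / b : ℝ) ≤ log (u / v) := by
    refine div_le_log_of_pow_le hb (by positivity) ?_
    have : (27183 : ℝ) ^ a * v ^ b ≤ 10000 ^ a * u ^ b := mod_cast h₂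
    rw [show (2.7183 : ℝ) = 27183 / 10000 by norm_num, div_pow, div_pow,
      div_le_div_iff₀ (by positivity) (by positivity)]
    linarith
  have hlogθ : (a / b : ℝ) ≤ log (θ n) := hlog.trans (log_le_log (by positivity) hθ)
  have hY : (0 : ℝ) < (∏ p ∈ Nat.primesLE z, (p - 1) : ℕ) := Nat.cast_pos.mpr <|
    Finset.prod_pos fun p hp ↦ Nat.sub_pos_of_lt (Nat.prime_of_mem_primesLE hp).one_lt
  calc _ ≤ 3 / 4 * ∏ p ∈ Nat.primesLE z, (p : ℝ) / (p - 1) :=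
        mul_le_mul_of_nonneg_left (prod_primesLE_div_sub_one_mono hnz) (by norm_num)
    _ < 71 / 40 * (a / b) := by
        rw [prod_primesLE_div_sub_one_eq, div_mul_div_comm, div_mul_div_comm,
          div_lt_div_iff₀ (by positivity) (by positivity)]
        have : (120 : ℝ) * b * (∏ p ∈ Nat.primesLE z, p : ℕ) <
          284 * a * (∏ p ∈ Nat.primesLE z, (p - 1) : ℕ) := by exact_mod_cast h₃
        linarith
    _ ≤ _ := by gcongr

theorem le_exp_eulerMascheroniConstant : 71 / 40 ≤ exp eulerMascheroniConstant := by
  have hγ : 23 / 40 ≤ eulerMascheroniConstant := by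
    refine le_trans ?_ (eulerMascheroniSeq_lt_eulerMascheroniConstant 255).le
    have hH : (61204 / 10000 : ℚ) ≤ harmonic 255 := by decide +kernel
    have hH' : ((61204 / 10000 : ℚ) : ℝ) ≤ (harmonic 255 : ℝ) := Rat.cast_le.mpr hH
    rw [Rat.cast_div, Rat.cast_ofNat, Rat.cast_ofNat] at hH'
    have hl : log ((255 : ℕ) + 1 : ℝ) = 8 * log 2 := by
      rw [show ((255 : ℕ) + 1 : ℝ) = 2 ^ 8 by norm_num, log_pow]
      norm_num
    rw [eulerMascheroniSeq, hl]
    linarith [log_two_lt_d9]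
  refine le_trans ?_ (exp_le_exp.mpr hγ)
  refine le_of_pow_le_pow_left₀ (n := 40) (by norm_num) (exp_pos _).le ?_
  rw [← exp_nat_mul, show ((40 : ℕ) : ℝ) * (23 / 40) = (23 : ℕ) * 1 by norm_num, exp_nat_mul]
  refine le_trans ?_ (pow_le_pow_left₀ (by norm_num) exp_one_gt_d9.le 23)
  norm_num

theorem prod_primesLE_seven_lt :
    3 / 4 * ∏ p ∈ Nat.primesLE 7, (p : ℝ) / (p - 1) <
      exp eulerMascheroniConstant * log (log 1240) := by
  have hP : Nat.primesLE 7 = {2, 3, 5, 7} := by decide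
  have h₁ : (71 / 10 : ℝ) ≤ log 1240 := by
    have := div_le_log_of_pow_le (a := 71) (b := 10) (t := 1240) (by norm_num) (by norm_num)
      (by norm_num)
    exact_mod_cast this
  have h₂ : (19 / 10 : ℝ) ≤ log (71 / 10) := by
    have := div_le_log_of_pow_le (a := 19) (b := 10) (t := 71 / 10) (by norm_num) (by norm_num)
      (by norm_num)
    exact_mod_cast this
  have h₃ : (19 / 10 : ℝ) ≤ log (log 1240) := h₂.trans (log_le_log (by norm_num) h₁)
  calc _ < (71 / 40 * (19 / 10) : ℝ) := by rw [hP]; norm_num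
    _ ≤ _ := mul_le_mul le_exp_eulerMascheroniConstant h₃ (by norm_num) (exp_pos _).le

theorem prod_primesLE_8192_le : 3 / 4 * ∏ p ∈ Nat.primesLE 8192, (p : ℝ) / (p - 1) ≤ 12.05 := by
  have h : 300 * primeProd (fun p ↦ if p ≤ 8191 then p else 1) 13 0 ≤
      4820 * primeProd (fun p ↦ if p ≤ 8191 then p - 1 else 1) 13 0 := by decide +kernel
  rw [← prod_primesLE_eq_primeProd (fun p ↦ p) (by norm_num) le_rfl,
    ← prod_primesLE_eq_primeProd (fun p ↦ p - 1) (by norm_num) le_rfl] at h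
  have hnp : ¬ Nat.Prime (8191 + 1) := by norm_num
  have hY : (0 : ℝ) < (∏ p ∈ Nat.primesLE 8191, (p - 1) : ℕ) := Nat.cast_pos.mpr <|
    Finset.prod_pos fun p hp ↦ Nat.sub_pos_of_lt (Nat.prime_of_mem_primesLE hp).one_lt
  have h' : (300 : ℝ) * (∏ p ∈ Nat.primesLE 8191, p : ℕ) ≤
      4820 * (∏ p ∈ Nat.primesLE 8191, (p - 1) : ℕ) := by exact_mod_cast h
  rw [Nat.primesLE_succ 8191, if_neg hnp, prod_primesLE_div_sub_one_eq, ← mul_div_assoc,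
    div_le_iff₀ hY]
  linarith

open Chebyshev in
theorem prod_primesLE_lt_log_theta {n : ℕ} (hn : 11 ≤ n) :
    3 / 4 * ∏ p ∈ Nat.primesLE n, (p : ℝ) / (p - 1) <
      exp eulerMascheroniConstant * log (θ n) := by
  have hG := le_exp_eulerMascheroniConstant
  have cert := @prod_primesLE_lt_log_theta_of_certificate _ hG
  rcases lt_or_ge n 13 with h | hx
  · exact cert 4 77 10 204 100 11 12 hn (Nat.le_pred_of_lt h)
      (by norm_num) (by norm_num) (by norm_num) (by norm_num) (by norm_num) (by norm_num)
      (by decide +kernel) (by decide +kernel) (by decide +kernel)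
  rcases lt_or_ge n 17 with h | hx
  · exact cert 5 103 10 233 100 13 16 hx (Nat.le_pred_of_lt h)
      (by norm_num) (by norm_num) (by norm_num) (by norm_num) (by norm_num) (by norm_num)
      (by decide +kernel) (by decide +kernel) (by decide +kernel)
  rcases lt_or_ge n 23 with h | hx
  · exact cert 5 131 10 257 100 17 22 hx (Nat.le_pred_of_lt h)
      (by norm_num) (by norm_num) (by norm_num) (by norm_num) (by norm_num) (by norm_num)
      (by decide +kernel) (by decide +kernel) (by decide +kernel)
  rcases lt_or_ge n 32 with h | hx
  · exact cert 5 192 10 295 100 23 31 hx (Nat.le_pred_of_lt h)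
      (by norm_num) (by norm_num) (by norm_num) (by norm_num) (by norm_num) (by norm_num)
      (by decide +kernel) (by decide +kernel) (by decide +kernel)
  rcases lt_or_ge n 64 with h | hx
  · exact cert 6 260 10 325 100 32 63 hx (Nat.le_pred_of_lt h)
      (by norm_num) (by norm_num) (by norm_num) (by norm_num) (by norm_num) (by norm_num)
      (by decide +kernel) (by decide +kernel) (by decide +kernel)
  rcases lt_or_ge n 128 with h | hx
  · exact cert 7 53 1 397 100 64 127 hx (Nat.le_pred_of_lt h)
      (by norm_num) (by norm_num) (by norm_num) (by norm_num) (by norm_num) (by norm_num)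
      (by decide +kernel) (by decide +kernel) (by decide +kernel)
  rcases lt_or_ge n 256 with h | hx
  · exact cert 8 111 1 470 100 128 255 hx (Nat.le_pred_of_lt h)
      (by norm_num) (by norm_num) (by norm_num) (by norm_num) (by norm_num) (by norm_num)
      (by decide +kernel) (by decide +kernel) (by decide +kernel)
  rcases lt_or_ge n 512 with h | hx
  · exact cert 9 232 1 544 100 256 511 hx (Nat.le_pred_of_lt h)
      (by norm_num) (by norm_num) (by norm_num) (by norm_num) (by norm_num) (by norm_num)
      (by decide +kernel) (by decide +kernel) (by decide +kernel)
  rcases lt_or_ge n 1024 with h | hx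
  · exact cert 10 487 1 618 100 512 1023 hx (Nat.le_pred_of_lt h)
      (by norm_num) (by norm_num) (by norm_num) (by norm_num) (by norm_num) (by norm_num)
      (by decide +kernel) (by decide +kernel) (by decide +kernel)
  rcases lt_or_ge n 2048 with h | hx
  · exact cert 11 983 1 689 100 1024 2047 hx (Nat.le_pred_of_lt h)
      (by norm_num) (by norm_num) (by norm_num) (by norm_num) (by norm_num) (by norm_num)
      (by decide +kernel) (by decide +kernel) (by decide +kernel)
  rcases lt_or_ge n 4096 with h | hx
  · exact cert 12 1985 1 759 100 2048 4095 hx (Nat.le_pred_of_lt h)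
      (by norm_num) (by norm_num) (by norm_num) (by norm_num) (by norm_num) (by norm_num)
      (by decide +kernel) (by decide +kernel) (by decide +kernel)
  rcases lt_or_ge n 8192 with h | hx
  · exact cert 13 4027 1 830 100 4096 8191 hx (Nat.le_pred_of_lt h)
      (by norm_num) (by norm_num) (by norm_num) (by norm_num) (by norm_num) (by norm_num)
      (by decide +kernel) (by decide +kernel) (by decide +kernel)
  exact prod_primesLE_lt_log_theta_of_large (by linarith) prod_primesLE_8192_le hx

/-- For every odd natural number `n ≥ 620`, Robin's inequality holds for `2n`. -/
theorem robin_two_mul_odd (n : ℕ) (hn : Odd n) (h : 620 ≤ n) :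
    RobinInequality (2 * n) :=
  robinInequality_two_mul_of_primorial prod_primesLE_seven_lt
    (fun _ hx ↦ prod_primesLE_lt_log_theta hx) hn h
end

section
/- The set of natural numbers satisfying Robin's inequality has natural density 1; that is, the quantity (1/s)·#{n : 1 ≤ n ≤ s and σ(n) < e^γ · n · log(log n)} tends to 1 as s → ∞. -/
open Real

open Filter

/-- The summatory function of `σ` is at most quadratic. -/
theorem sum_Ioc_sigma_one_le_sq (s : ℕ) :
    ∑ n ∈ Finset.Ioc 0 s, ArithmeticFunction.sigma 1 n ≤ s ^ 2 := by
  have h := ArithmeticFunction.sum_Ioc_mul_zeta_eq_sum (ArithmeticFunction.pow 1) s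
  rw [mul_comm, ArithmeticFunction.natCoe_nat, ArithmeticFunction.zeta_mul_pow_eq_sigma] at h
  rw [h]
  calc ∑ n ∈ Finset.Ioc 0 s, ArithmeticFunction.pow 1 n * ((s / n : ℕ) : ℕ)
      ≤ ∑ _n ∈ Finset.Ioc 0 s, s := Finset.sum_le_sum fun n _ => by
        simpa [ArithmeticFunction.pow_apply] using Nat.mul_div_le s n
    _ = s ^ 2 := by simp [sq]

/-- Any fixed bound `σ(n) < K n` implies Robin's inequality once `n` is large. -/
theorem eventually_robinInequality_of_sigma_lt (K : ℝ) :
    ∀ᶠ n : ℕ in atTop,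
      (ArithmeticFunction.sigma 1 n : ℝ) < K * n → RobinInequality n := by
  have hlim : Tendsto
      (fun n : ℕ => Real.exp Real.eulerMascheroniConstant * Real.log (Real.log n)) atTop atTop :=
    (Real.tendsto_log_atTop.comp
      (Real.tendsto_log_atTop.comp tendsto_natCast_atTop_atTop)).const_mul_atTop
      (Real.exp_pos _)
  filter_upwards [hlim.eventually_ge_atTop K] with n hn hσ
  refine hσ.trans_le ((mul_le_mul_of_nonneg_right hn n.cast_nonneg).trans_eq ?_)
  ring

open Classical in
/-- The exceptions to Robin's inequality have density zero. -/
theorem eventually_card_not_robinInequality_le {ε : ℝ} (hε : 0 < ε) :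
    ∀ᶠ s : ℕ in atTop,
      (((Finset.Ioc 0 s).filter fun n => ¬ RobinInequality n).card : ℝ) ≤ ε * s := by
  set δ := ε / 3 with hδ
  have hδ0 : 0 < δ := by positivity
  obtain ⟨N, hN⟩ := eventually_atTop.1 (eventually_robinInequality_of_sigma_lt (1 / δ ^ 2))
  filter_upwards [(tendsto_natCast_atTop_atTop (R := ℝ)).eventually_ge_atTop (N / δ),
    eventually_gt_atTop 0] with s hs hs0
  have hs0' : (0 : ℝ) < s := by exact_mod_cast hs0
  set B := (Finset.Ioc 0 s).filter fun n : ℕ =>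
    δ * s < n ∧ 1 / δ ^ 2 * n ≤ (ArithmeticFunction.sigma 1 n : ℝ) with hB
  have hsub : ((Finset.Ioc 0 s).filter fun n => ¬ RobinInequality n) ⊆
      (Finset.Ioc 0 N ∪ Finset.Ioc 0 ⌊δ * s⌋₊) ∪ B := by
    intro n hn
    simp only [Finset.mem_filter, Finset.mem_Ioc, Finset.mem_union, hB] at hn ⊢
    by_cases h1 : n ≤ N
    · exact Or.inl (Or.inl ⟨hn.1.1, h1⟩)
    by_cases h2 : (n : ℝ) ≤ δ * s
    · exact Or.inl (Or.inr ⟨hn.1.1, Nat.le_floor h2⟩)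
    · exact Or.inr ⟨hn.1, not_le.1 h2,
        not_lt.1 fun h => hn.2 (hN n (not_le.1 h1).le h)⟩
  have hcard : (((Finset.Ioc 0 s).filter fun n => ¬ RobinInequality n).card : ℝ) ≤
      N + ⌊δ * s⌋₊ + B.card := by
    have h := (Finset.card_le_card hsub).trans ((Finset.card_union_le _ _).trans
      (Nat.add_le_add_right (Finset.card_union_le _ _) _))
    simp only [Nat.card_Ioc, Nat.sub_zero] at h
    exact_mod_cast h
  have hBcard : (B.card : ℝ) ≤ δ * s := by
    have hsum : (B.card : ℝ) * (s / δ) ≤ (s : ℝ) ^ 2 := by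
      calc (B.card : ℝ) * (s / δ) = ∑ _n ∈ B, (s / δ : ℝ) := by simp
        _ ≤ ∑ n ∈ B, (ArithmeticFunction.sigma 1 n : ℝ) := by
          refine Finset.sum_le_sum fun n hn => ?_
          obtain ⟨-, h1, h2⟩ := Finset.mem_filter.1 hn
          refine le_trans ?_ h2
          calc (s / δ : ℝ) = 1 / δ ^ 2 * (δ * s) := by field_simp
            _ ≤ 1 / δ ^ 2 * n := by gcongr
        _ ≤ ∑ n ∈ Finset.Ioc 0 s, (ArithmeticFunction.sigma 1 n : ℝ) :=
          Finset.sum_le_sum_of_subset_of_nonneg (Finset.filter_subset _ _)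
            fun _ _ _ => Nat.cast_nonneg _
        _ ≤ (s : ℝ) ^ 2 := by exact_mod_cast sum_Ioc_sigma_one_le_sq s
    rw [← mul_div_assoc, div_le_iff₀ hδ0] at hsum
    nlinarith
  have hfloor : (⌊δ * s⌋₊ : ℝ) ≤ δ * s := Nat.floor_le (by positivity)
  rw [div_le_iff₀ hδ0] at hs
  have hε' : ε = 3 * δ := by rw [hδ]; ring
  rw [hε']
  linarith

/-- The set of natural numbers satisfying Robin's inequality has natural
density `1`. -/
theorem robin_density_one :
    Tendsto
      (fun s : ℕ => ({n : ℕ | 1 ≤ n ∧ n ≤ s ∧ RobinInequality n}.ncard : ℝ) / s)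
      atTop (nhds 1) := by
  classical
  rw [Metric.tendsto_nhds]
  intro ε hε
  filter_upwards [eventually_card_not_robinInequality_le (half_pos hε), eventually_gt_atTop 0]
    with s hs hs0
  have hs0' : (0 : ℝ) < s := by exact_mod_cast hs0
  have hset : {n : ℕ | 1 ≤ n ∧ n ≤ s ∧ RobinInequality n} =
      ((Finset.Ioc 0 s).filter RobinInequality : Finset ℕ) := by
    ext n
    simp [Nat.succ_le_iff, and_assoc]
  have hadd : (((Finset.Ioc 0 s).filter RobinInequality).card : ℝ) +
      ((Finset.Ioc 0 s).filter fun n => ¬ RobinInequality n).card = s := by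
    have h := Finset.card_filter_add_card_filter_not (s := Finset.Ioc 0 s) RobinInequality
    rw [Nat.card_Ioc, Nat.sub_zero] at h
    exact_mod_cast h
  rw [hset, Set.ncard_coe_finset, Real.dist_eq, div_sub_one hs0'.ne', abs_div,
    abs_of_pos hs0', div_lt_iff₀ hs0', abs_lt]
  constructor <;> nlinarith [Nat.cast_nonneg (α := ℝ)
    ((Finset.Ioc 0 s).filter fun n => ¬ RobinInequality n).card, mul_pos hε hs0']
end

section
/- For every natural number k ≥ 99 and each j ∈ {1, 2, 3}, writing m = (p₁·p₂⋯p_{k+1})/p_j for the product of the first k+1 primes divided by the j-th prime, one has log(log m) > log((k+1)·(log(k+1) + log(log(k+1)) − 1)·log(2.51) − log(p_j)). -/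
lemma Nat.prod_range_count_nth {p : ℕ → Prop} [DecidablePred p] (N : ℕ) :
    ∏ i ∈ Finset.range (Nat.count p N), Nat.nth p i = ∏ i ∈ Finset.range N with p i, i := by
  induction N with
  | zero => simp
  | succ N ih =>
    rw [Nat.count_succ, Finset.range_add_one, Finset.filter_insert]
    split_ifs with h
    · rw [Finset.prod_range_succ, ih, Nat.nth_count h, Finset.prod_insert (by simp), mul_comm]
    · simpa using ih

lemma Nat.mul_primeCounting'_le {x : ℕ} (hx : 211 ≤ x) :
    209 * Nat.primeCounting' x ≤ 48 * x := by
  induction x using Nat.strong_induction_on with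
  | _ x ih =>
    by_cases h : x < 420
    · have key : ∀ y < 209,
          209 * Nat.count Nat.Prime (211 + y) ≤ 48 * (211 + y) := by decide +kernel
      have := key (x - 211) (by omega)
      rwa [Nat.add_sub_cancel' hx] at this
    · have h₁ := ih (x - 209) (by omega) (by omega)
      have h₂ := Nat.primeCounting'_add_le (a := 210) (k := x - 209) (by norm_num) (by omega) 209
      rw [Nat.sub_add_cancel (by omega), show Nat.totient 210 = 48 by decide +kernel] at h₂
      omega

lemma Nat.le_nth_prime_of_hundred_le {n : ℕ} (hn : 100 ≤ n) :
    (4.3 : ℝ) * (n + 1) ≤ Nat.nth Nat.Prime n := by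
  have hp : 211 ≤ Nat.nth Nat.Prime n := by
    by_contra! h
    have h₁ := Nat.monotone_primeCounting' h.le
    rw [Nat.primeCounting'_nth_eq] at h₁
    have h₂ : Nat.primeCounting' 211 < 100 := by decide +kernel
    omega
  have h := Nat.mul_primeCounting'_le hp
  rw [Nat.primeCounting'_nth_eq] at h
  have h' : (209 : ℝ) * n ≤ 48 * Nat.nth Nat.Prime n := mod_cast h
  have hn' : (100 : ℝ) ≤ n := mod_cast hn
  linarith

lemma Real.log_le_log_add_div_sub_one {a x : ℝ} (ha : 0 < a) (hx : 0 < x) :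
    Real.log x ≤ Real.log a + x / a - 1 := by
  have h := Real.log_le_sub_one_of_pos (div_pos hx ha)
  rw [Real.log_div hx.ne' ha.ne'] at h
  linarith

lemma Real.log_three_le : Real.log 3 ≤ 1.1023 := by
  have h₁ := Real.log_le_log_add_div_sub_one (a := 8) (x := 9) (by norm_num) (by norm_num)
  rw [show (8 : ℝ) = 2 ^ 3 by norm_num, show (9 : ℝ) = 3 ^ 2 by norm_num,
    Real.log_pow, Real.log_pow] at h₁
  have h₂ := Real.log_two_lt_d9
  norm_num at h₁ h₂ ⊢
  linarith

lemma Real.log_five_le : Real.log 5 ≤ 1.6096 := by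
  have h₁ := Real.log_le_log_add_div_sub_one (a := 128) (x := 125) (by norm_num) (by norm_num)
  rw [show (128 : ℝ) = 2 ^ 7 by norm_num, show (125 : ℝ) = 5 ^ 3 by norm_num,
    Real.log_pow, Real.log_pow] at h₁
  have h₂ := Real.log_two_lt_d9
  norm_num at h₁ h₂ ⊢
  linarith

lemma Real.log_251_div_100_le : Real.log 2.51 ≤ 0.9205 := by
  have h₁ := Real.log_le_log_add_div_sub_one (a := 5 / 2) (x := 2.51) (by norm_num) (by norm_num)
  rw [Real.log_div (by norm_num) (by norm_num)] at h₁
  have h₂ := Real.log_two_gt_d9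
  have h₃ := Real.log_five_le
  norm_num at h₁ h₂ h₃ ⊢
  linarith

lemma Real.le_log_43_div_10 : 1.456 ≤ Real.log 4.3 := by
  have h₁ := Real.log_le_log_add_div_sub_one (a := 4.3) (x := 4) (by norm_num) (by norm_num)
  rw [show (4 : ℝ) = 2 ^ 2 by norm_num, Real.log_pow] at h₁
  have h₂ := Real.log_two_gt_d9
  norm_num at h₁ h₂ ⊢
  linarith

lemma Real.log_hundred_le : Real.log 100 ≤ 4.606 := by
  rw [show (100 : ℝ) = 2 ^ 2 * 5 ^ 2 by norm_num, Real.log_mul (by norm_num) (by norm_num),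
    Real.log_pow, Real.log_pow]
  have h₂ := Real.log_two_lt_d9
  have h₃ := Real.log_five_le
  norm_num at h₂ h₃ ⊢
  linarith

lemma Real.le_log_hundred : 4.6 ≤ Real.log 100 := by
  have h₁ := Real.log_le_log_add_div_sub_one (a := 100) (x := 96) (by norm_num) (by norm_num)
  have h₃ := Real.log_le_log_add_div_sub_one (a := 9) (x := 8) (by norm_num) (by norm_num)
  rw [show (96 : ℝ) = 2 ^ 5 * 3 by norm_num, Real.log_mul (by norm_num) (by norm_num),
    Real.log_pow] at h₁
  rw [show (8 : ℝ) = 2 ^ 3 by norm_num, show (9 : ℝ) = 3 ^ 2 by norm_num,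
    Real.log_pow, Real.log_pow] at h₃
  have h₂ := Real.log_two_gt_d9
  norm_num at h₁ h₂ h₃ ⊢
  linarith

lemma Real.mul_add_log_add_inv_le {L : ℝ} (hL : 4.6 ≤ L) :
    0.9205 * (L + Real.log L + 1 / L) ≤ 1.456 + L := by
  have hL0 : 0 < L := by linarith
  have h₂ := Real.log_two_lt_d9
  suffices 0.9205 * (L + Real.log L) + 0.9205 * (1 / L) ≤ 1.456 + L by linarith
  rcases le_total L 9.2 with h | h
  · have h₁ := Real.log_le_log_add_div_sub_one (a := 2 ^ 3) (by norm_num) hL0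
    rw [Real.log_pow] at h₁
    have h₃ : 1 / L ≤ (4.6 + 9.2 - L) / (4.6 * 9.2) := by
      rw [div_le_div_iff₀ hL0 (by norm_num)]
      nlinarith
    norm_num at *
    linarith
  · have h₁ := Real.log_le_log_add_div_sub_one (a := 2 ^ 2 * 3) (by norm_num) hL0
    rw [Real.log_mul (by norm_num) (by norm_num), Real.log_pow] at h₁
    have h₃ : 1 / L ≤ 1 / 9.2 := one_div_le_one_div_of_le (by norm_num) h
    have h₄ := Real.log_three_le
    norm_num at *
    linarith

lemma Real.hasDerivAt_mul_log_add_log_log_sub_one {x : ℝ} (hx : 1 < x) :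
    HasDerivAt (fun y => y * (Real.log y + Real.log (Real.log y) - 1))
      (Real.log x + Real.log (Real.log x) + 1 / Real.log x) x := by
  have hx0 : x ≠ 0 := by positivity
  have hl : Real.log x ≠ 0 := (Real.log_pos hx).ne'
  have h := (hasDerivAt_id x).mul (((Real.hasDerivAt_log hx0).add
    ((Real.hasDerivAt_log hx0).log hl)).sub_const 1)
  refine h.congr_deriv ?_
  simp only [id, Pi.add_apply]
  field_simp
  ring

lemma Real.mul_log_add_log_log_sub_one_succ_le {x : ℝ} (hx : 100 ≤ x) :
    0.9205 * ((x + 1) * (Real.log (x + 1) + Real.log (Real.log (x + 1)) - 1) -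
      x * (Real.log x + Real.log (Real.log x) - 1)) ≤ Real.log (4.3 * (x + 1)) := by
  obtain ⟨ξ, ⟨h₁, h₂⟩, h⟩ := exists_hasDerivAt_eq_slope
    (fun y => y * (Real.log y + Real.log (Real.log y) - 1))
    (fun y => Real.log y + Real.log (Real.log y) + 1 / Real.log y) (lt_add_one x)
    (fun y hy => (Real.hasDerivAt_mul_log_add_log_log_sub_one
      (by linarith [hy.1])).continuousAt.continuousWithinAt)
    (fun y hy => Real.hasDerivAt_mul_log_add_log_log_sub_one (by linarith [hy.1]))
  rw [add_sub_cancel_left, div_one] at h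
  rw [← h, Real.log_mul (by norm_num) (by linarith)]
  have h₃ : Real.log 100 ≤ Real.log ξ := Real.log_le_log (by norm_num) (by linarith)
  have h₄ : Real.log ξ ≤ Real.log (x + 1) := Real.log_le_log (by linarith) h₂.le
  linarith [Real.mul_add_log_add_inv_le (Real.le_log_hundred.trans h₃), Real.le_log_43_div_10]

set_option exponentiation.threshold 500 in
lemma Nat.log_prod_first_hundred_primes :
    480 ≤ Real.log (∏ i ∈ Finset.range 100, Nat.nth Nat.Prime i : ℕ) := by
  have hc : Nat.count Nat.Prime 542 = 100 := by decide +kernel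
  rw [← hc, Nat.prod_range_count_nth]
  have hb : 27183 ^ 480 ≤ 10000 ^ 480 * ∏ i ∈ Finset.range 542 with Nat.Prime i, i := by
    decide +kernel
  generalize ∏ i ∈ Finset.range 542 with Nat.Prime i, i = N at hb
  have hb' : (27183 : ℝ) ^ 480 ≤ 10000 ^ 480 * N := mod_cast hb
  have hN : (2.7183 : ℝ) ^ 480 ≤ N := by
    rw [show (2.7183 : ℝ) = 27183 / 10000 by norm_num, div_pow, div_le_iff₀ (by positivity)]
    linarith
  have he : Real.exp 480 ≤ N := by
    refine le_trans ?_ hN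
    rw [show (480 : ℝ) = (480 : ℕ) * 1 by norm_num, Real.exp_nat_mul]
    exact pow_le_pow_left₀ (Real.exp_pos 1).le
      (Real.exp_one_lt_d9.le.trans (by norm_num)) 480
  exact (Real.le_log_iff_exp_le ((Real.exp_pos _).trans_le he)).2 he

lemma Nat.lt_log_prod_nth_prime {n : ℕ} (hn : 100 ≤ n) :
    0.9205 * (n * (Real.log n + Real.log (Real.log n) - 1)) <
      Real.log (∏ i ∈ Finset.range n, Nat.nth Nat.Prime i : ℕ) := by
  induction n, hn using Nat.le_induction with
  | base =>
    refine lt_of_lt_of_le ?_ Nat.log_prod_first_hundred_primes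
    have h₁ := Real.log_hundred_le
    have h₂ := Real.le_log_hundred
    have h₃ := Real.log_le_log_add_div_sub_one (a := 4) (x := Real.log 100) (by norm_num)
      (by linarith)
    rw [show Real.log 4 = 2 * Real.log 2 by
      rw [show (4 : ℝ) = 2 ^ 2 by norm_num, Real.log_pow]; norm_num] at h₃
    have h₄ := Real.log_two_lt_d9
    push_cast
    norm_num at *
    linarith
  | succ n hn ih =>
    have hn' : (100 : ℝ) ≤ n := mod_cast hn
    have hp : (Nat.nth Nat.Prime n : ℝ) ≠ 0 := mod_cast (Nat.prime_nth_prime n).ne_zero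
    have hP : ((∏ i ∈ Finset.range n, Nat.nth Nat.Prime i : ℕ) : ℝ) ≠ 0 :=
      mod_cast Finset.prod_ne_zero_iff.2 fun i _ => (Nat.prime_nth_prime i).ne_zero
    rw [Finset.prod_range_succ, Nat.cast_mul, Real.log_mul hP hp, Nat.cast_add_one]
    have h₁ := Real.mul_log_add_log_log_sub_one_succ_le hn'
    have h₂ := Real.log_le_log (by positivity) (Nat.le_nth_prime_of_hundred_le hn)
    linarith

/-- For `k ≥ 99` and `j ∈ {1, 2, 3}`, writing `m = (p₁⋯p_{k+1})/p_j`, one has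
`log(log m) > log((k+1)·(log(k+1) + log(log(k+1)) − 1)·log(2.51) − log(p_j))`.
Here `Nat.nth Nat.Prime (j-1)` is the `j`-th prime `p_j`. -/
theorem log_log_primorial_div_prime_gt (k j : ℕ) (hk : 99 ≤ k)
    (hj : j = 1 ∨ j = 2 ∨ j = 3)
    (m : ℕ)
    (hm : m = (∏ i ∈ Finset.range (k + 1), Nat.nth Nat.Prime i) /
      Nat.nth Nat.Prime (j - 1)) :
    Real.log (Real.log m) >
      Real.log ((k + 1) *
          (Real.log (k + 1) + Real.log (Real.log (k + 1)) - 1) * Real.log 2.51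
        - Real.log (Nat.nth Nat.Prime (j - 1))) := by
  have hk' : (100 : ℝ) ≤ k + 1 := by
    have : (99 : ℝ) ≤ k := mod_cast hk
    linarith
  have hp := Nat.prime_nth_prime (j - 1)
  have hp5 : Nat.nth Nat.Prime (j - 1) ≤ 5 := by rcases hj with rfl | rfl | rfl <;> simp
  have hdvd : Nat.nth Nat.Prime (j - 1) ∣ ∏ i ∈ Finset.range (k + 1), Nat.nth Nat.Prime i :=
    Finset.dvd_prod_of_mem _ (Finset.mem_range.2 (by omega))
  have hP : ((∏ i ∈ Finset.range (k + 1), Nat.nth Nat.Prime i : ℕ) : ℝ) ≠ 0 :=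
    mod_cast Finset.prod_ne_zero_iff.2 fun i _ => (Nat.prime_nth_prime i).ne_zero
  have hp0 : (Nat.nth Nat.Prime (j - 1) : ℝ) ≠ 0 := mod_cast hp.ne_zero
  have hlt := Nat.lt_log_prod_nth_prime (n := k + 1) (by omega)
  rw [hm, Nat.cast_div hdvd hp0, Real.log_div hP hp0]
  push_cast at hlt ⊢
  have hlog : 4.6 ≤ Real.log (k + 1) :=
    Real.le_log_hundred.trans (Real.log_le_log (by norm_num) hk')
  have hloglog : 0 ≤ Real.log (Real.log (k + 1 : ℝ)) := Real.log_nonneg (by linarith)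
  have hG : 360 ≤ ((k : ℝ) + 1) * (Real.log (k + 1) + Real.log (Real.log (k + 1)) - 1) := by
    nlinarith
  have hc : 1 / 2 ≤ Real.log 2.51 := by
    refine le_trans ?_ (Real.log_le_log (by norm_num) (by norm_num : (2 : ℝ) ≤ 2.51))
    linarith [Real.log_two_gt_d9]
  have hlogp : Real.log (Nat.nth Nat.Prime (j - 1)) ≤ 5 :=
    (Real.log_le_self (Nat.cast_nonneg _)).trans (mod_cast hp5)
  have hc' := Real.log_251_div_100_le
  refine Real.log_lt_log ?_ ?_
  · nlinarith
  · nlinarith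
end

section
/- For every real number x ≥ 1, H(x) < log x + γ + 1/(2x). -/
open Real

/-- The continuous interpolation `H(x) = ∫₀¹ (tˣ − 1)/(t − 1) dt` of the
harmonic numbers. -/
noncomputable def harmonicInterp (x : ℝ) : ℝ :=
  ∫ t in (0 : ℝ)..1, (t ^ x - 1) / (t - 1)

open MeasureTheory Filter Topology

lemma intervalIntegrable_rpow_sub_one_div {x : ℝ} (hx : 1 ≤ x) :
    IntervalIntegrable (fun t : ℝ ↦ (t ^ x - 1) / (t - 1)) volume 0 1 := by
  refine (intervalIntegrable_const (c := x)).mono_fun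
    (by fun_prop : Measurable fun t : ℝ ↦ (t ^ x - 1) / (t - 1)).aestronglyMeasurable ?_
  rw [Set.uIoc_of_le zero_le_one]
  refine (ae_restrict_iff' measurableSet_Ioc).2 (.of_forall fun t ht ↦ ?_)
  have hx0 : 0 ≤ x := by linarith
  have hbern := one_add_mul_self_le_rpow_one_add (s := t - 1) (by linarith [ht.1]) hx
  rw [add_sub_cancel] at hbern
  have hle : t ^ x ≤ 1 := rpow_le_one ht.1.le ht.2 hx0
  simp only [norm_eq_abs]
  rw [abs_of_nonneg hx0,
    abs_of_nonneg (div_nonneg_of_nonpos (by linarith) (by linarith [ht.2]))]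
  rcases ht.2.eq_or_lt with rfl | h
  · simpa using hx0
  · rw [div_le_iff_of_neg (by linarith)]
    linarith

lemma harmonicInterp_mono {x y : ℝ} (hx : 1 ≤ x) (hxy : x ≤ y) :
    harmonicInterp x ≤ harmonicInterp y := by
  refine intervalIntegral.integral_mono_on_of_le_Ioo zero_le_one
    (intervalIntegrable_rpow_sub_one_div hx)
    (intervalIntegrable_rpow_sub_one_div (hx.trans hxy)) fun t ht ↦ ?_
  refine div_le_div_of_nonpos_of_le (by linarith [ht.2]) ?_
  linarith [rpow_le_rpow_of_exponent_ge ht.1 ht.2.le hxy]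

lemma harmonicInterp_add_one {x : ℝ} (hx : 1 ≤ x) :
    harmonicInterp (x + 1) = harmonicInterp x + 1 / (x + 1) := by
  have hint : ∫ t in (0 : ℝ)..1, t ^ x = 1 / (x + 1) := by
    rw [integral_rpow (Or.inl (by linarith)), one_rpow, zero_rpow (by linarith : 0 < x + 1).ne', sub_zero]
  rw [harmonicInterp, harmonicInterp, ← hint, ← intervalIntegral.integral_add
    (intervalIntegrable_rpow_sub_one_div hx)
    (intervalIntegral.intervalIntegrable_rpow' (by linarith))]
  refine intervalIntegral.integral_congr_Ioo_of_le zero_le_one fun t ht ↦ ?_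
  have h1 : t - 1 ≠ 0 := sub_ne_zero.2 ht.2.ne
  simp only [rpow_add_one ht.1.ne']
  field_simp
  ring

lemma harmonicInterp_one : harmonicInterp 1 = 1 := by
  have : harmonicInterp 1 = ∫ _ in (0 : ℝ)..1, (1 : ℝ) := by
    refine intervalIntegral.integral_congr_Ioo_of_le zero_le_one fun t ht ↦ ?_
    have h1 : t - 1 ≠ 0 := sub_ne_zero.2 ht.2.ne
    simp only [rpow_one, div_self h1]
  simpa using this

lemma harmonicInterp_natCast {n : ℕ} (hn : 1 ≤ n) : harmonicInterp n = harmonic n := by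
  induction n, hn using Nat.le_induction with
  | base => simp [harmonicInterp_one]
  | succ n hn ih =>
    rw [Nat.cast_add_one, harmonicInterp_add_one (by exact_mod_cast hn), ih, harmonic_succ]
    push_cast
    rw [one_div]

lemma log_add_one_sub_log_lt {x : ℝ} (hx : 0 < x) :
    log (x + 1) - log x < (1 / x + 1 / (x + 1)) / 2 := by
  have hy : 1 < (x + 1) / x := by rw [one_lt_div hx]; linarith
  have h := self_lt_sinh_iff.2 (log_pos hy)
  rw [sinh_log (by positivity), log_div (by positivity) hx.ne'] at h
  convert h using 2
  field_simp
  ring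

lemma harmonicInterp_sub_lt_succ {x : ℝ} (hx : 1 ≤ x) :
    harmonicInterp x - log x - 1 / (2 * x) <
      harmonicInterp (x + 1) - log (x + 1) - 1 / (2 * (x + 1)) := by
  have h := log_add_one_sub_log_lt (x := x) (by linarith)
  have h2 (y : ℝ) : 1 / (2 * y) = 1 / y / 2 := by rw [div_div, mul_comm]
  rw [harmonicInterp_add_one hx, h2, h2]
  linarith

lemma harmonicInterp_sub_le {x : ℝ} (hx : 1 ≤ x) :
    harmonicInterp x - log x - 1 / (2 * x) ≤ eulerMascheroniConstant := by
  set g : ℝ → ℝ := fun y ↦ harmonicInterp y - log y - 1 / (2 * y) with hg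
  have hmono : Monotone fun n : ℕ ↦ g (x + n) := monotone_nat_of_le_succ fun n ↦ by
    have h := harmonicInterp_sub_lt_succ (x := x + n) (by linarith [n.cast_nonneg (α := ℝ)])
    simpa only [hg, Nat.cast_add_one, ← add_assoc] using h.le
  set m := ⌈x⌉₊
  have hxm : x ≤ m := Nat.le_ceil x
  have hlim : Tendsto (fun n : ℕ ↦ ((harmonic (n + m) : ℝ) - log (n + m : ℕ)) +
      ((log (n + m) - log n) - (log (n + x) - log n))) atTop (𝓝 eulerMascheroniConstant) := by
    have hlog (y : ℝ) : Tendsto (fun n : ℕ ↦ log (n + y) - log n) atTop (𝓝 0) :=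
      (tendsto_log_comp_add_sub_log y).comp tendsto_natCast_atTop_atTop
    simpa using (tendsto_harmonic_sub_log.comp (tendsto_add_atTop_nat m)).add
      ((hlog m).sub (hlog x))
  refine ge_of_tendsto hlim (.of_forall fun n ↦ ?_)
  have hn : (0 : ℝ) ≤ n := n.cast_nonneg
  have h0 : g x ≤ g (x + n) := by simpa using hmono (Nat.zero_le n)
  have hle : harmonicInterp (x + n) ≤ harmonic (n + m) := by
    have h1 : (1 : ℝ) ≤ (n + m : ℕ) := by push_cast; linarith
    rw [← harmonicInterp_natCast (by exact_mod_cast h1)]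
    exact harmonicInterp_mono (by linarith) (by push_cast; linarith)
  have hpos : 0 ≤ 1 / (2 * (x + n)) := by positivity
  push_cast
  rw [add_comm (n : ℝ) x]
  simp only [hg] at h0
  linarith

/-- For every real `x ≥ 1`, `H(x) < log x + γ + 1/(2x)`. -/
theorem harmonicInterp_lt (x : ℝ) (hx : 1 ≤ x) :
    harmonicInterp x <
      Real.log x + Real.eulerMascheroniConstant + 1 / (2 * x) := by
  linarith [harmonicInterp_sub_lt_succ hx, harmonicInterp_sub_le (x := x + 1) (by linarith)]
end

section
/- For every real number x ≥ 4, log(H(x)) ≤ x/(2·log(x)). -/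
open Real

/-- The integrand of `harmonicInterp` is at most the harmonic mean of its two upper bounds
`x` and `1 / (1 - t)`. -/
lemma norm_harmonicInterp_integrand_le {x t : ℝ} (hx : 1 ≤ x) (ht0 : 0 ≤ t) (ht1 : t ≤ 1) :
    ‖(t ^ x - 1) / (t - 1)‖ ≤ 2 * x / (1 + x * (1 - t)) := by
  have hx0 : 0 ≤ x := by linarith
  have hden : 0 < 1 + x * (1 - t) := by nlinarith
  have hpow0 : 0 ≤ t ^ x := rpow_nonneg ht0 x
  have hpow1 : t ^ x ≤ 1 := rpow_le_one ht0 ht1 hx0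
  have bernoulli : 1 + x * (t - 1) ≤ t ^ x := by
    have h := one_add_mul_self_le_rpow_one_add (s := t - 1) (by linarith) hx
    rwa [add_sub_cancel] at h
  rcases ht1.eq_or_lt with rfl | ht
  · simp only [sub_self, div_zero, norm_zero]
    positivity
  · rw [norm_div, norm_of_nonpos (by linarith), norm_of_nonpos (by linarith),
      div_le_div_iff₀ (by linarith) hden]
    nlinarith [mul_nonneg hpow0 (mul_nonneg hx0 (sub_nonneg.2 ht1))]

lemma abs_harmonicInterp_le {x : ℝ} (hx : 1 ≤ x) :
    |harmonicInterp x| ≤ 2 * log (1 + x) := by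
  have hden : ∀ t ∈ Set.uIcc (0 : ℝ) 1, 0 < 1 + x * (1 - t) := by
    intro t ht
    rw [Set.uIcc_of_le zero_le_one] at ht
    nlinarith [ht.2]
  have hint : IntervalIntegrable (fun t : ℝ ↦ 2 * x / (1 + x * (1 - t)))
      MeasureTheory.volume 0 1 := by
    apply ContinuousOn.intervalIntegrable
    exact ContinuousOn.div (by fun_prop) (by fun_prop) fun t ht ↦ (hden t ht).ne'
  have heq : ∫ t in (0 : ℝ)..1, 2 * x / (1 + x * (1 - t)) = 2 * log (1 + x) := by
    rw [intervalIntegral.integral_eq_sub_of_hasDerivAt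
      (f := fun t : ℝ ↦ -2 * log (1 + x * (1 - t))) _ hint]
    · simp
    · intro t ht
      have hlin : HasDerivAt (fun t : ℝ ↦ 1 + x * (1 - t)) (x * (-1)) t :=
        (((hasDerivAt_id t).const_sub 1).const_mul x).const_add 1
      refine ((hlin.log (hden t ht).ne').const_mul (-2)).congr_deriv ?_
      ring
  rw [← heq, ← norm_eq_abs]
  refine intervalIntegral.norm_integral_le_of_norm_le zero_le_one
    (Filter.Eventually.of_forall fun t ht ↦ ?_) hint
  exact norm_harmonicInterp_integrand_le hx ht.1.le ht.2

/-- For every real `x ≥ 4`, `log(H(x)) ≤ x/(2·log(x))`. -/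
theorem log_harmonicInterp_le (x : ℝ) (hx : 4 ≤ x) :
    Real.log (harmonicInterp x) ≤ x / (2 * Real.log x) := by
  have hx0 : 0 < x := by linarith
  have hL : 0 < log x := log_pos (by linarith)
  rcases eq_or_ne (harmonicInterp x) 0 with h0 | h0
  · rw [h0, log_zero]
    positivity
  have hlog : log (1 + x) ≤ log x + 1 / 4 := by
    have h : log ((1 + x) / x) ≤ (1 + x) / x - 1 := log_le_sub_one_of_pos (by positivity)
    rw [log_div (by positivity) hx0.ne', add_div, div_self hx0.ne'] at h
    have : 1 / x ≤ 1 / 4 := one_div_le_one_div_of_le (by norm_num) hx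
    linarith
  have hH : |harmonicInterp x| ≤ 2 * (log x + 1 / 4) := by
    linarith [abs_harmonicInterp_le (show 1 ≤ x by linarith)]
  have htangent : log (2 * (log x + 1 / 4)) ≤ 2 * log 2 + ((log x + 1 / 4) / 2 - 1) := by
    have h := log_le_sub_one_of_pos (show 0 < (log x + 1 / 4) / 2 by positivity)
    rw [show 2 * (log x + 1 / 4) = 2 * 2 * ((log x + 1 / 4) / 2) by ring,
      log_mul (by norm_num) (by positivity), log_mul (by norm_num) (by norm_num)]
    linarith
  have hexp : 1 + log x + log x ^ 2 / 2 + log x ^ 3 / 6 ≤ x := by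
    have h := sum_le_exp_of_nonneg hL.le 4
    rw [exp_log hx0] at h
    norm_num [Finset.sum_range_succ, Nat.factorial] at h
    exact h
  calc log (harmonicInterp x) = log |harmonicInterp x| := (log_abs _).symm
    _ ≤ log (2 * (log x + 1 / 4)) := log_le_log (abs_pos.2 h0) hH
    _ ≤ log x / 2 + 0.5115 := by linarith [log_two_lt_d9]
    _ ≤ x / (2 * log x) := by
      rw [le_div_iff₀ (by positivity)]
      nlinarith [mul_nonneg hL.le (sq_nonneg (log x - 2)), sq_nonneg (log x - 2)]
end

section
/- For every real number x ≥ 4, H(x)·log(H(x)) < x²/(x + 6/π²). -/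
open Real

theorem harmonicInterp_integrand_le {x t : ℝ} (hx : 1 ≤ x) (h0 : 0 ≤ t) (h1 : t ≤ 1) :
    (t ^ x - 1) / (t - 1) ≤ x := by
  rcases h1.eq_or_lt with rfl | h1
  · simpa using zero_le_one.trans hx
  · rw [div_le_iff_of_neg (by linarith)]
    have := one_add_mul_self_le_rpow_one_add (s := t - 1) (by linarith) hx
    rw [add_sub_cancel] at this
    linarith

theorem harmonicInterp_integrand_le_inv {x t : ℝ} (h0 : 0 ≤ t) (h1 : t ≤ 1) :
    (t ^ x - 1) / (t - 1) ≤ (1 - t)⁻¹ := by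
  have ht : 0 ≤ t ^ x := rpow_nonneg h0 x
  rw [← neg_div_neg_eq, neg_sub, neg_sub, inv_eq_one_div]
  exact div_le_div_of_nonneg_right (by linarith) (by linarith)

theorem harmonicInterp_nonneg {x : ℝ} (hx : 0 ≤ x) : 0 ≤ harmonicInterp x := by
  refine intervalIntegral.integral_nonneg zero_le_one fun t ht => ?_
  have := rpow_le_one ht.1 ht.2 hx
  exact div_nonneg_of_nonpos (by linarith) (by linarith [ht.2])

theorem harmonicInterp_le_one_add_log {x : ℝ} (hx : 1 ≤ x) :
    harmonicInterp x ≤ 1 + log x := by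
  have hx0 : 0 < x := by linarith
  by_cases hi : IntervalIntegrable (fun t : ℝ => (t ^ x - 1) / (t - 1)) MeasureTheory.volume 0 1
  swap
  · rw [harmonicInterp, intervalIntegral.integral_undef hi]
    linarith [log_nonneg hx]
  have hinv : x⁻¹ ≤ 1 := inv_le_one_of_one_le₀ hx
  have hpos : 0 < x⁻¹ := inv_pos.2 hx0
  have hl : IntervalIntegrable (fun t : ℝ => (t ^ x - 1) / (t - 1)) MeasureTheory.volume 0 (1 - x⁻¹) := by
    refine hi.mono_set ?_
    rw [Set.uIcc_of_le (by linarith), Set.uIcc_of_le zero_le_one]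
    exact Set.Icc_subset_Icc_right (by linarith)
  have hr : IntervalIntegrable (fun t : ℝ => (t ^ x - 1) / (t - 1)) MeasureTheory.volume (1 - x⁻¹) 1 := by
    refine hi.mono_set ?_
    rw [Set.uIcc_of_le (by linarith), Set.uIcc_of_le zero_le_one]
    exact Set.Icc_subset_Icc_left (by linarith)
  have hleft : ∫ t in (0 : ℝ)..(1 - x⁻¹), (t ^ x - 1) / (t - 1) ≤ log x := by
    have hg : IntervalIntegrable (fun t : ℝ => (1 - t)⁻¹) MeasureTheory.volume 0 (1 - x⁻¹) := by
      refine ContinuousOn.intervalIntegrable (ContinuousOn.inv₀ (by fun_prop) fun t ht => ?_)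
      rw [Set.uIcc_of_le (by linarith)] at ht
      linarith [ht.2]
    calc ∫ t in (0 : ℝ)..(1 - x⁻¹), (t ^ x - 1) / (t - 1)
        ≤ ∫ t in (0 : ℝ)..(1 - x⁻¹), (1 - t)⁻¹ :=
          intervalIntegral.integral_mono_on (by linarith) hl hg fun t ht =>
            harmonicInterp_integrand_le_inv ht.1 (by linarith [ht.2])
      _ = log x := by
          rw [intervalIntegral.integral_comp_sub_left (fun t : ℝ => t⁻¹) 1, sub_sub_cancel,
            sub_zero, integral_inv_of_pos hpos one_pos, one_div, inv_inv]
  have hright : ∫ t in (1 - x⁻¹)..1, (t ^ x - 1) / (t - 1) ≤ 1 := by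
    calc ∫ t in (1 - x⁻¹)..1, (t ^ x - 1) / (t - 1)
        ≤ ∫ _ in (1 - x⁻¹)..1, x :=
          intervalIntegral.integral_mono_on (by linarith) hr (by simp) fun t ht =>
            harmonicInterp_integrand_le hx (by linarith [ht.1]) ht.2
      _ = 1 := by
          rw [intervalIntegral.integral_const, smul_eq_mul, sub_sub_cancel,
            inv_mul_cancel₀ hx0.ne']
  rw [harmonicInterp, ← intervalIntegral.integral_add_adjacent_intervals hl hr]
  linarith

theorem log_le_half_add_log_two_sub_one {y : ℝ} (hy : 0 < y) :
    log y ≤ y / 2 + log 2 - 1 := by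
  have := log_le_sub_one_of_pos (half_pos hy)
  rw [log_div hy.ne' two_ne_zero] at this
  linarith

theorem mul_log_le_sq_div_two {y : ℝ} (hy : 0 ≤ y) : y * log y ≤ y ^ 2 / 2 := by
  rcases hy.eq_or_lt with rfl | hy
  · simp
  · nlinarith [log_le_half_add_log_two_sub_one hy, log_two_lt_d9]

theorem one_add_log_le_mul_sqrt {x : ℝ} (hx : 4 ≤ x) : 1 + log x ≤ 6 / 5 * √x := by
  have hs : 2 ≤ √x := le_sqrt_of_sq_le (by linarith)
  have := log_le_half_add_log_two_sub_one (y := √x) (by linarith)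
  rw [log_sqrt (by linarith)] at this
  linarith [log_two_lt_d9]

/-- For every real `x ≥ 4`, `H(x)·log(H(x)) < x²/(x + 6/π²)`. -/
theorem harmonicInterp_mul_log_lt (x : ℝ) (hx : 4 ≤ x) :
    harmonicInterp x * Real.log (harmonicInterp x) <
      x ^ 2 / (x + 6 / Real.pi ^ 2) := by
  have h0 : 0 ≤ harmonicInterp x := harmonicInterp_nonneg (by linarith)
  have hH : harmonicInterp x ≤ 6 / 5 * √x :=
    (harmonicInterp_le_one_add_log (by linarith)).trans (one_add_log_le_mul_sqrt hx)
  have hsq : harmonicInterp x ^ 2 ≤ 36 / 25 * x := by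
    calc harmonicInterp x ^ 2 ≤ (6 / 5 * √x) ^ 2 := pow_le_pow_left₀ h0 hH 2
      _ = 36 / 25 * x := by rw [mul_pow, sq_sqrt (by linarith)]; norm_num
  have hpi : 6 / π ^ 2 ≤ 1 := by
    rw [div_le_one (by positivity)]
    nlinarith [pi_gt_three]
  have hpi0 : 0 < 6 / π ^ 2 := by positivity
  calc harmonicInterp x * log (harmonicInterp x)
      ≤ harmonicInterp x ^ 2 / 2 := mul_log_le_sq_div_two h0
    _ ≤ 18 / 25 * x := by linarith
    _ < x ^ 2 / (x + 6 / π ^ 2) := by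
        rw [lt_div_iff₀ (by linarith)]
        nlinarith
end
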